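/- arXiv:2012.14551 — 3 statements merged into one kernel-verified Lean document; each statement's English description precedes it below -/
import Mathlib

section
/- Let G be a connected graph with at least three edges. Then the second iterated line graph L^2(G) = L(L(G)) is traceable if and only if EUP_2(G) is nonempty. -/
open SimpleGraph

namespace Paper

/-- A graph is traceable if it has a hamiltonian path. -/
def Traceable {α : Type*} (G : SimpleGraph α) : Prop :=
  ∃ (a b : α) (p : G.Walk a b), p.IsPath ∧ ∀ w, w ∈ p.support

/-- A graph is hamiltonian if it has a hamiltonian cycle. -/
def HamGraph {α : Type*} (G : SimpleGraph α) : Prop :=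
  ∃ (a : α) (p : G.Walk a a), p.IsCycle ∧ ∀ w, w ∈ p.support

/-- A graph together with its (varying) vertex type. -/
def GraphSys : Type 1 := Σ V : Type, SimpleGraph V

/-- One application of the line-graph operator. -/
def lineStep (p : GraphSys) : GraphSys := ⟨p.2.edgeSet, p.2.lineGraph⟩

/-- The `n`-th iterated line graph (with `L^0(G) = G`). -/
def iterLine (p : GraphSys) (n : ℕ) : GraphSys := lineStep^[n] p

/-- The hamiltonian path index: the least `n` with `L^n(G)` traceable. -/
noncomputable def hp {V : Type} (G : SimpleGraph V) : ℕ :=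
  sInf {n | Traceable (iterLine ⟨V, G⟩ n).2}

/-- The hamiltonian index: the least `n` with `L^n(G)` hamiltonian. -/
noncomputable def hIndex {V : Type} (G : SimpleGraph V) : ℕ :=
  sInf {n | HamGraph (iterLine ⟨V, G⟩ n).2}

/-- Degree of `v` in a subgraph `H` (number of neighbours). -/
noncomputable def sdeg {V : Type*} {G : SimpleGraph V} (H : G.Subgraph) (v : V) : ℕ :=
  (H.neighborSet v).ncard

/-- Degree of `v` in `G` (number of neighbours). -/
noncomputable def gdeg {V : Type*} (G : SimpleGraph V) (v : V) : ℕ :=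
  (G.neighborSet v).ncard

/-- `Ē(H)`: the set of edges of `G` incident with a vertex of `H`. -/
def barE {V : Type*} (G : SimpleGraph V) (H : G.Subgraph) : Set (Sym2 V) :=
  {e | e ∈ G.edgeSet ∧ ∃ v ∈ H.verts, v ∈ e}

/-- A circuit: a connected subgraph in which every vertex has even degree
(`K₁` counts as a circuit). -/
def IsCircuit {V : Type*} {G : SimpleGraph V} (H : G.Subgraph) : Prop :=
  H.Connected ∧ ∀ v, Even (sdeg H v)

/-- A branch of `G`: a nontrivial path whose ends have degree `≠ 2` and whose
internal vertices have degree `2`. -/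
def IsBranch {V : Type*} (G : SimpleGraph V) {u v : V} (p : G.Walk u v) : Prop :=
  p.IsPath ∧ 0 < p.length ∧ gdeg G u ≠ 2 ∧ gdeg G v ≠ 2 ∧
    ∀ w ∈ p.support, w ≠ u → w ≠ v → gdeg G w = 2

/-- The family `EUP_k(G)` of subgraphs satisfying (I'), (II), (III), (IV), (V'). -/
def EUP {V : Type*} (G : SimpleGraph V) (k : ℕ) : Set (G.Subgraph) :=
  {H | {v | Odd (sdeg H v)}.ncard ≤ 2 ∧
    (∀ v ∈ H.verts, H.neighborSet v = ∅ → 3 ≤ gdeg G v) ∧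
    (∀ v, 3 ≤ gdeg G v → v ∈ H.verts) ∧
    (∀ H1 : G.Subgraph, H1 ≤ H → H1.verts.Nonempty → (H.verts \ H1.verts).Nonempty →
      ∃ a ∈ H1.verts, ∃ b ∈ H.verts \ H1.verts, G.dist a b ≤ k - 1) ∧
    (∀ (u v : V) (p : G.Walk u v), IsBranch G p →
      (∀ e ∈ p.edges, e ∉ H.edgeSet) → p.length ≤ k + 1) ∧
    (∀ (u v : V) (p : G.Walk u v), IsBranch G p → (∃ w ∈ p.support, gdeg G w = 1) →
      (∀ e ∈ p.edges, e ∉ H.edgeSet) → p.length ≤ k)}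

/-- The family `EU_k(G)` of subgraphs satisfying (I), (II), (III), (IV), (V). -/
def EU {V : Type*} (G : SimpleGraph V) (k : ℕ) : Set (G.Subgraph) :=
  {H | (∀ v, Even (sdeg H v)) ∧
    (∀ v ∈ H.verts, H.neighborSet v = ∅ → 3 ≤ gdeg G v) ∧
    (∀ v, 3 ≤ gdeg G v → v ∈ H.verts) ∧
    (∀ H1 : G.Subgraph, H1 ≤ H → H1.verts.Nonempty → (H.verts \ H1.verts).Nonempty →
      ∃ a ∈ H1.verts, ∃ b ∈ H.verts \ H1.verts, G.dist a b ≤ k - 1) ∧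
    (∀ (u v : V) (p : G.Walk u v), IsBranch G p →
      (∀ e ∈ p.edges, e ∉ H.edgeSet) → p.length ≤ k + 1) ∧
    (∀ (u v : V) (p : G.Walk u v), IsBranch G p → (∃ w ∈ p.support, gdeg G w = 1) →
      p.length ≤ k)}

/-- A dominating, connected, (semi-)Eulerian subgraph `F` of `X` with vertex set `S`. -/
structure DomSub {α : Type*} (X F : SimpleGraph α) (S : Set α) : Prop where
  le : F ≤ X
  ne : S.Nonempty
  mem : ∀ x y, F.Adj x y → x ∈ S
  cut : ∀ A : Set α, (∃ a ∈ S, a ∈ A) → (∃ b ∈ S, b ∉ A) → ∃ a ∈ A, ∃ b, b ∉ A ∧ F.Adj a b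
  odd : {x | Odd (gdeg F x)}.ncard ≤ 2
  dom : ∀ x y, X.Adj x y → x ∈ S ∨ y ∈ S

lemma gdeg_eq_edges {α : Type*} (G : SimpleGraph α) (x : α) :
    gdeg G x = {e | e ∈ G.edgeSet ∧ x ∈ e}.ncard := by
  classical
  have h := Nat.card_congr (G.incidenceSetEquivNeighborSet x)
  rw [Nat.card_coe_set_eq, Nat.card_coe_set_eq] at h
  exact h.symm

lemma ncard_list {β : Type*} (l : List β) (hl : l.Nodup) (P : β → Prop) [DecidablePred P] :
    {e | e ∈ l ∧ P e}.ncard = l.countP (fun e => decide (P e)) := by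
  classical
  have : {e | e ∈ l ∧ P e} = ((l.filter (fun e => decide (P e))).toFinset : Set β) := by
    ext e; simp
  rw [this, Set.ncard_coe_finset, List.toFinset_card_of_nodup (hl.filter _), List.countP_eq_length_filter]

lemma trail_par {α : Type*} {G : SimpleGraph α} {u v : α} {p : G.Walk u v} (ht : p.IsTrail)
    (x : α) : Even ({e | e ∈ p.edges ∧ x ∈ e}.ncard) ↔ (u ≠ v → x ≠ u ∧ x ≠ v) := by
  classical
  rw [ncard_list _ ht.edges_nodup, ← ht.even_countP_edges_iff x]

lemma exists_longest {α : Type*} [Finite α] (F : SimpleGraph α) (a : α) :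
    ∃ (b : α) (w : F.Walk a b), w.IsTrail ∧
      ∀ (b' : α) (w' : F.Walk a b'), w'.IsTrail → w'.length ≤ w.length := by
  classical
  have := Fintype.ofFinite α
  let s := {n | ∃ (b : α) (w : F.Walk a b), w.IsTrail ∧ w.length = n}
  have hb : BddAbove s := ⟨F.edgeFinset.card, by
    rintro n ⟨b, w, hw, rfl⟩; exact hw.length_le_card_edgeFinset⟩
  have hne : s.Nonempty := ⟨0, a, .nil, .nil, rfl⟩
  obtain ⟨b, w, hw, hl⟩ := Nat.sSup_mem hne hb
  refine ⟨b, w, hw, fun b' w' hw' => ?_⟩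
  rw [hl]
  exact le_csSup hb ⟨b', w', hw', rfl⟩

lemma longest_end {α : Type*} {F : SimpleGraph α} {a b : α} {w : F.Walk a b} (hw : w.IsTrail)
    (hm : ∀ (b' : α) (w' : F.Walk a b'), w'.IsTrail → w'.length ≤ w.length) (z : α)
    (hz : F.Adj b z) : s(b, z) ∈ w.edges := by
  by_contra h
  have : (w.concat hz).IsTrail := by
    rw [Walk.concat_eq_append, Walk.isTrail_append]
    refine ⟨hw, by simp, by simpa using h⟩
  have := hm _ _ this
  simp at this

lemma longest_deg {α : Type*} {F : SimpleGraph α} {a b : α} {w : F.Walk a b} (hw : w.IsTrail)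
    (hm : ∀ (b' : α) (w' : F.Walk a b'), w'.IsTrail → w'.length ≤ w.length) :
    gdeg F b = {e | e ∈ w.edges ∧ b ∈ e}.ncard := by
  rw [gdeg_eq_edges]
  congr 1
  ext e
  constructor
  · rintro ⟨h1, h2⟩
    obtain ⟨z, rfl⟩ := h2
    exact ⟨longest_end hw hm z h1, by simp⟩
  · rintro ⟨h1, h2⟩
    exact ⟨w.edges_subset_edgeSet h1, h2⟩

lemma closed_longest {α : Type*} {F : SimpleGraph α} (hev : ∀ x, Even (gdeg F x)) {a b : α}
    {w : F.Walk a b} (hw : w.IsTrail)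
    (hm : ∀ (b' : α) (w' : F.Walk a b'), w'.IsTrail → w'.length ≤ w.length) : a = b := by
  by_contra hab
  have h := hev b
  rw [longest_deg hw hm, trail_par hw] at h
  exact (h hab).2 rfl

lemma euler {α : Type*} [Finite α] (F : SimpleGraph α) (S : Set α) (hne : S.Nonempty)
    (hmem : ∀ x y, F.Adj x y → x ∈ S)
    (hcut : ∀ A : Set α, (∃ a ∈ S, a ∈ A) → (∃ b ∈ S, b ∉ A) → ∃ a ∈ A, ∃ b, b ∉ A ∧ F.Adj a b)
    (hodd : {x | Odd (gdeg F x)}.ncard ≤ 2) :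
    ∃ (a b : α) (w : F.Walk a b), w.IsTrail ∧ ∀ x ∈ S, x ∈ w.support := by
  classical
  obtain ⟨a, haS, ha⟩ : ∃ a ∈ S, (∃ x, Odd (gdeg F x)) → Odd (gdeg F a) := by
    by_cases h : ∃ x, Odd (gdeg F x)
    · obtain ⟨x, hx⟩ := h
      have : (F.neighborSet x).Nonempty := by
        apply Set.nonempty_of_ncard_ne_zero
        intro h0; unfold gdeg at hx; rw [h0] at hx; simp at hx
      obtain ⟨y, hy⟩ := this
      exact ⟨x, hmem x y hy, fun _ => hx⟩
    · obtain ⟨a, ha⟩ := hne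
      exact ⟨a, ha, fun h' => absurd h' h⟩
  obtain ⟨b, w, hw, hm⟩ := exists_longest F a
  refine ⟨a, b, w, hw, ?_⟩
  have hbd := longest_deg hw hm
  have hpar : ∀ x, Odd (gdeg F x) ↔ Odd ({e | e ∈ w.edges ∧ x ∈ e}.ncard) := by
    intro x
    by_cases hab : a = b
    · have hb : Even (gdeg F b) := by
        rw [hbd, trail_par hw]; exact fun h => absurd hab h
      have h1 : ¬ Odd (gdeg F x) := by
        intro hx
        have := ha ⟨x, hx⟩
        rw [hab] at this
        exact Nat.not_odd_iff_even.2 hb this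
      have h2 : Even ({e | e ∈ w.edges ∧ x ∈ e}.ncard) := by
        rw [trail_par hw]; exact fun h => absurd hab h
      exact ⟨fun h => absurd h h1, fun h => absurd h2 (Nat.not_even_iff_odd.2 h)⟩
    · have hb : Odd (gdeg F b) := by
        rw [hbd, ← Nat.not_even_iff_odd, trail_par hw]; intro h; exact (h hab).2 rfl
      have hao := ha ⟨b, hb⟩
      have hset : ({a, b} : Set α) = {x | Odd (gdeg F x)} := by
        apply Set.eq_of_subset_of_ncard_le
        · rintro y (rfl | rfl)
          · exact hao
          · exact hb
        · rw [Set.ncard_pair hab]; exact hodd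
        · exact Set.toFinite _
      have : Odd (gdeg F x) ↔ x ∈ ({a, b} : Set α) := by rw [hset]; rfl
      rw [this, ← Nat.not_even_iff_odd, trail_par hw]
      simp only [Set.mem_insert_iff, Set.mem_singleton_iff]
      tauto
  let R := F.deleteEdges {e | e ∈ w.edges}
  have hR : ∀ x, Even (gdeg R x) := by
    intro x
    have : gdeg F x = gdeg R x + {e | e ∈ w.edges ∧ x ∈ e}.ncard := by
      rw [gdeg_eq_edges, gdeg_eq_edges, ← Set.ncard_union_eq]
      · congr 1
        ext e
        have := @w.edges_subset_edgeSet
        simp only [R, edgeSet_deleteEdges, Set.mem_ofPred_eq, Set.mem_union, Set.mem_sdiff]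
        constructor
        · rintro ⟨h1, h2⟩; tauto
        · rintro (h | h)
          · tauto
          · exact ⟨this h.1, h.2⟩
      · rw [Set.disjoint_left]
        intro e h1 h2
        simp only [R, edgeSet_deleteEdges, Set.mem_ofPred_eq, Set.mem_sdiff] at h1 h2
        tauto
    have h2 := hpar x
    rw [this] at h2
    by_contra h3
    rw [Nat.not_even_iff_odd] at h3
    rcases Nat.even_or_odd ({e | e ∈ w.edges ∧ x ∈ e}.ncard) with h4 | h4
    · exact Nat.not_odd_iff_even.2 h4 (h2.1 (h3.add_even h4))
    · exact Nat.not_odd_iff_even.2 (h3.add_odd h4) (h2.2 h4)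
  by_contra hx
  push Not at hx
  obtain ⟨x, hxS, hx⟩ := hx
  obtain ⟨y, hy, z, hz, hyz⟩ := hcut {v | v ∈ w.support} ⟨a, haS, by simp⟩ ⟨x, hxS, hx⟩
  have hy' : y ∈ w.support := hy
  have hyzR : R.Adj y z := by
    rw [deleteEdges_adj]
    refine ⟨hyz, fun h => hz ?_⟩
    exact w.snd_mem_support_of_mem_edges h
  obtain ⟨y', q, hq, hqm⟩ := exists_longest R y
  obtain rfl := closed_longest hR hq hqm
  have hql : 0 < q.length := by
    have := hqm z (.cons hyzR .nil) (by simp)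
    simp at this; omega
  have hle : R ≤ F := F.deleteEdges_le _
  have hnew : ((w.takeUntil y hy').append ((q.mapLe hle).append (w.dropUntil y hy'))).IsTrail := by
    have hdq : ∀ e ∈ q.edges, e ∉ w.edges := by
      intro e he
      have := q.edges_subset_edgeSet he
      simp only [R, edgeSet_deleteEdges, Set.mem_sdiff] at this
      exact this.2
    rw [Walk.isTrail_append, Walk.isTrail_append]
    refine ⟨hw.takeUntil hy', ⟨by simpa using hq, hw.dropUntil hy', ?_⟩, ?_⟩
    · intro e he he'
      rw [Walk.edges_mapLe_eq_edges] at he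
      exact hdq e he (w.edges_dropUntil_subset_edges hy' he')
    · intro e he he'
      rw [Walk.edges_append, List.mem_append, Walk.edges_mapLe_eq_edges] at he'
      rcases he' with h | h
      · exact hdq e h (w.edges_takeUntil_subset_edges hy' he)
      · exact hw.disjoint_edges_takeUntil_dropUntil hy' he h
  have := hm _ _ hnew
  have h2 : (w.takeUntil y hy').length + (w.dropUntil y hy').length = w.length := by
    rw [← Walk.length_append, Walk.take_spec]
  simp only [Walk.length_append, Walk.length_mapLe] at this
  omega

lemma trail_to_list {α : Type*} {X : SimpleGraph α} {x y : α} (w : X.Walk x y) (hw : w.IsTrail) :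
    ∀ A : List X.edgeSet, A.Nodup → (∀ e ∈ A, e.1 ∉ w.edges) →
      (∀ e ∈ A, ∃ v ∈ w.support, v ∈ e.1) →
      ∃ l : List X.edgeSet, l.Nodup ∧ l.IsChain X.lineGraph.Adj ∧ (∀ e ∈ A, e ∈ l) ∧
        (∀ e : X.edgeSet, e ∈ l → e ∈ A ∨ e.1 ∈ w.edges) ∧
        (∀ e : X.edgeSet, e.1 ∈ w.edges → e ∈ l) ∧
        ∀ e ∈ l.head?, x ∈ e.1 := by
  classical
  have pw : ∀ (x : α) (l : List X.edgeSet), l.Nodup → (∀ e ∈ l, x ∈ e.1) →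
      l.IsChain X.lineGraph.Adj := by
    intro x l hl hx
    apply List.Pairwise.isChain
    rw [List.pairwise_iff_forall_sublist]
    intro a b hab
    rw [lineGraph_adj_iff_exists]
    refine ⟨?_, x, hx a (hab.subset (by simp)), hx b (hab.subset (by simp))⟩
    have := hab.nodup hl
    simpa using this
  induction w with
  | nil =>
    intro A hA _ h2
    simp only [Walk.support_nil, List.mem_singleton, exists_eq_left] at h2
    refine ⟨A, hA, pw _ A hA h2, fun e h => h, fun e h => Or.inl h, by simp, ?_⟩
    intro e he
    exact h2 e (List.mem_of_mem_head? he)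
  | @cons x x' y h w ih =>
    intro A hA h1 h2
    rw [Walk.isTrail_cons] at hw
    obtain ⟨l, hl, hc, hAl, hlA, hwl, hhd⟩ := ih hw.1 (A.filter (fun e => x ∉ e.1)) (hA.filter _)
      (by
        intro e he
        have := h1 e (List.mem_of_mem_filter he)
        simp at this; exact this.2)
      (by
        intro e he
        simp only [List.mem_filter, decide_eq_true_eq] at he
        obtain ⟨v, hv, hve⟩ := h2 e he.1
        simp only [Walk.support_cons, List.mem_cons] at hv
        rcases hv with rfl | hv
        · exact absurd hve he.2
        · exact ⟨v, hv, hve⟩)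
    let g : X.edgeSet := ⟨s(x, x'), h⟩
    have hgl : g ∉ l := by
      intro hg
      rcases hlA g hg with h' | h'
      · simp [g] at h'
      · exact hw.2 h'
    refine ⟨A.filter (fun e => x ∈ e.1) ++ g :: l, ?_, ?_, ?_, ?_, ?_, ?_⟩
    · rw [List.nodup_append]
      refine ⟨hA.filter _, ?_, ?_⟩
      · rw [List.nodup_cons]; exact ⟨hgl, hl⟩
      · intro a ha b hb hab
        subst hab
        simp only [List.mem_filter, decide_eq_true_eq] at ha
        rw [List.mem_cons] at hb
        rcases hb with rfl | hb
        · have := h1 _ ha.1; simp [g] at this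
        · rcases hlA a hb with h' | h'
          · simp at h'; exact h'.2 ha.2
          · have := h1 a ha.1; simp [h'] at this
    · rw [List.isChain_append]
      refine ⟨pw x _ (hA.filter _) ?_, ?_, ?_⟩
      · intro e he; simp only [List.mem_filter, decide_eq_true_eq] at he; exact he.2
      · rw [List.isChain_cons]
        refine ⟨?_, hc⟩
        intro e he
        rw [lineGraph_adj_iff_exists]
        refine ⟨?_, x', by simp [g], hhd e he⟩
        rintro rfl
        exact hgl (List.mem_of_mem_head? he)
      · intro e he f hf
        simp only [List.head?_cons, Option.mem_def, Option.some.injEq] at hf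
        subst hf
        have he' := List.mem_of_mem_getLast? he
        simp only [List.mem_filter, decide_eq_true_eq] at he'
        rw [lineGraph_adj_iff_exists]
        refine ⟨?_, x, he'.2, by simp [g]⟩
        rintro rfl
        have := h1 _ he'.1; simp [g] at this
    · intro e he
      by_cases hx : x ∈ e.1
      · simp [he, hx]
      · have := hAl e (by simp [he, hx]); simp [this]
    · intro e he
      simp only [List.mem_append, List.mem_filter, List.mem_cons, decide_eq_true_eq] at he
      rcases he with he | rfl | he
      · exact Or.inl he.1
      · right; simp [g]
      · rcases hlA e he with h' | h'
        · simp at h'; exact Or.inl h'.1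
        · right; simp [h']
    · intro e he
      simp only [Walk.edges_cons, List.mem_cons] at he
      rcases he with he | he
      · have : e = g := Subtype.ext he
        simp [this]
      · simp [hwl e he]
    · intro e he
      rw [List.head?_append] at he
      cases hh : (A.filter (fun e => x ∈ e.1)).head? with
      | none => rw [hh] at he; simp at he; subst he; simp [g]
      | some f =>
        rw [hh] at he; simp at he; subst he
        have := List.mem_of_mem_head? hh
        simp only [List.mem_filter, decide_eq_true_eq] at this
        exact this.2

lemma DomSub.traceable {α : Type*} [Finite α] {X F : SimpleGraph α} {S : Set α}
    (h : DomSub X F S) (hX : X.edgeSet.Nonempty) : Traceable X.lineGraph := by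
  classical
  obtain ⟨a, b, w, hw, hS⟩ := euler F S h.ne h.mem h.cut h.odd
  have : Fintype X.edgeSet := Fintype.ofFinite _
  obtain ⟨l, hl, hc, hAl, -, hwl, -⟩ := trail_to_list (w.mapLe h.le) (by simpa using hw)
    ((Finset.univ : Finset X.edgeSet).toList.filter (fun e => e.1 ∉ (w.mapLe h.le).edges))
    ((Finset.nodup_toList _).filter _) (by intro e he; simpa using he)
    (by
      rintro ⟨e, he'⟩ he
      induction e with
      | _ u v =>
        rcases h.dom u v he' with h | h
        · exact ⟨u, by simpa using hS _ h, by simp⟩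
        · exact ⟨v, by simpa using hS _ h, by simp⟩)
  have hall : ∀ e, e ∈ l := by
    intro e
    by_cases he : e.1 ∈ (w.mapLe h.le).edges
    · exact hwl e he
    · exact hAl e (by simpa using he)
  have hne : l ≠ [] := by
    rintro rfl
    obtain ⟨e, he⟩ := hX
    simpa using hall ⟨e, he⟩
  refine ⟨_, _, Walk.ofSupport l hne hc, ?_, ?_⟩
  · rw [Walk.isPath_def, Walk.support_ofSupport]; exact hl
  · intro e; rw [Walk.support_ofSupport]; exact hall e

lemma list_to_trail {α : Type*} {X : SimpleGraph α} (l : List X.edgeSet) :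
    ∀ f : X.edgeSet, (f :: l).Nodup → (f :: l).IsChain X.lineGraph.Adj →
      ∃ (x y : α) (w : X.Walk x y), w.IsTrail ∧ x ∈ f.1 ∧ (∀ e ∈ w.edges, ∃ g ∈ l, g.1 = e) ∧
        ∀ e ∈ f :: l, ∃ v ∈ w.support, v ∈ e.1 := by
  induction l with
  | nil =>
    rintro ⟨f, hf⟩ _ _
    induction f with
    | _ u v => exact ⟨u, u, .nil, by simp, by simp, by simp, by simp⟩
  | cons g l ih =>
    intro f hn hc
    rw [List.isChain_cons_cons] at hc
    rw [List.nodup_cons] at hn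
    obtain ⟨x, y, w, hw, hx, hwl, hd⟩ := ih g hn.2 hc.2
    obtain ⟨hfg, v, hvf, hvg⟩ := lineGraph_adj_iff_exists.1 hc.1
    by_cases hvx : v = x
    · subst hvx
      refine ⟨v, y, w, hw, hvf, ?_, ?_⟩
      · intro e he; obtain ⟨g', hg', h⟩ := hwl e he; exact ⟨g', by simp [hg'], h⟩
      · intro e he
        rw [List.mem_cons] at he
        rcases he with rfl | he
        · exact ⟨v, by simp, hvf⟩
        · exact hd e he
    · have hg : g.1 = s(v, x) := ((Sym2.mem_and_mem_iff hvx).1 ⟨hvg, hx⟩)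
      have hadj : X.Adj v x := by
        have := g.2; rw [hg] at this; exact this
      refine ⟨v, y, .cons hadj w, ?_, hvf, ?_, ?_⟩
      · rw [Walk.isTrail_cons]
        refine ⟨hw, fun h => ?_⟩
        obtain ⟨g', hg', h⟩ := hwl _ h
        rw [← hg] at h
        have := Subtype.ext h
        subst this
        exact (List.nodup_cons.1 hn.2).1 hg'
      · intro e he
        rw [Walk.edges_cons, List.mem_cons] at he
        rcases he with rfl | he
        · exact ⟨g, by simp, hg⟩
        · obtain ⟨g', hg', h⟩ := hwl e he; exact ⟨g', by simp [hg'], h⟩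
      · intro e he
        rw [List.mem_cons] at he
        rcases he with rfl | he
        · exact ⟨v, by simp, hvf⟩
        · obtain ⟨z, hz, hze⟩ := hd e he
          exact ⟨z, by simp [hz], hze⟩

lemma DomSub.of_traceable {α : Type*} [Finite α] {X : SimpleGraph α} (h : Traceable X.lineGraph) :
    ∃ F S, DomSub X F S := by
  classical
  obtain ⟨a, b, p, hp, hall⟩ := h
  obtain ⟨x, y, w, hw, -, -, hd⟩ := list_to_trail p.support.tail a
    (by rw [Walk.cons_tail_support]; exact hp.support_nodup)
    (by rw [Walk.cons_tail_support]; exact p.isChain_adj_support)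
  rw [Walk.cons_tail_support] at hd
  have hadj : ∀ u v, (fromEdgeSet {e | e ∈ w.edges}).Adj u v ↔ s(u, v) ∈ w.edges := by
    intro u v
    rw [fromEdgeSet_adj]
    constructor
    · exact fun h => h.1
    · exact fun h => ⟨h, (w.adj_of_mem_edges h).ne⟩
  refine ⟨fromEdgeSet {e | e ∈ w.edges}, {v | v ∈ w.support}, ?_, ?_, ?_, ?_, ?_, ?_⟩
  · intro u v huv
    exact w.adj_of_mem_edges ((hadj u v).1 huv)
  · exact ⟨x, by simp⟩
  · intro u v huv
    exact w.fst_mem_support_of_mem_edges ((hadj u v).1 huv)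
  · rintro A ⟨a, ha, haA⟩ ⟨b, hb, hbA⟩
    have key : ∀ (B : Set α) (u v : α), u ∈ B → v ∉ B → ∀ (q : X.Walk u v),
        (∀ e ∈ q.edges, e ∈ w.edges) →
        ∃ a ∈ B, ∃ b, b ∉ B ∧ (fromEdgeSet {e | e ∈ w.edges}).Adj a b := by
      intro B u v hu hv q hq
      obtain ⟨d, hd, h1, h2⟩ := q.exists_boundary_dart B hu hv
      refine ⟨d.fst, h1, d.snd, h2, (hadj _ _).2 (hq _ ?_)⟩
      exact List.mem_map.2 ⟨d, hd, rfl⟩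
    have ta := fun e h => (w.edges_takeUntil_subset_edges ha (a := e)) h
    have tb := fun e h => (w.edges_takeUntil_subset_edges hb (a := e)) h
    by_cases hx : x ∈ A
    · exact key A x b hx hbA (w.takeUntil b hb) tb
    · obtain ⟨c, hc, d, hd, hcd⟩ := key Aᶜ x a hx (by simpa using haA) (w.takeUntil a ha) ta
      exact ⟨d, by simpa using hd, c, hc, hcd.symm⟩
  · have : {z | Odd (gdeg (fromEdgeSet {e | e ∈ w.edges}) z)} ⊆ {x, y} := by
      intro z hz
      have hz : Odd (gdeg (fromEdgeSet {e | e ∈ w.edges}) z) := hz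
      rw [gdeg_eq_edges] at hz
      have hs : {e | e ∈ (fromEdgeSet {e | e ∈ w.edges}).edgeSet ∧ z ∈ e} =
          {e | e ∈ w.edges ∧ z ∈ e} := by
        ext e
        induction e with
        | _ u v => 
          simp only [mem_edgeSet, hadj, Set.mem_ofPred_eq]
      rw [hs, ← Nat.not_even_iff_odd, trail_par hw] at hz
      simp only [Set.mem_insert_iff, Set.mem_singleton_iff]
      tauto
    exact (Set.ncard_le_ncard this (Set.toFinite _)).trans (Set.ncard_insert_le _ _ |>.trans (by simp))
  · intro u v huv
    obtain ⟨z, hz, hze⟩ := hd ⟨s(u, v), huv⟩ (hall _)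
    simp only [Sym2.mem_iff] at hze
    rcases hze with rfl | rfl
    · exact Or.inl hz
    · exact Or.inr hz

lemma exists_match {α : Type*} [DecidableEq α] (n : ℕ) : ∀ U : Finset α, U.card = 2 * n →
    ∃ σ : α → α, ∀ x ∈ U, σ x ∈ U ∧ σ x ≠ x ∧ σ (σ x) = x := by
  induction n with
  | zero => intro U hU; exact ⟨id, by simp_all⟩
  | succ n ih =>
    intro U hU
    obtain ⟨x, hx, y, hy, hxy⟩ := Finset.one_lt_card.1 (by omega : 1 < U.card)
    obtain ⟨σ, hσ⟩ := ih ((U.erase x).erase y) (by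
      rw [Finset.card_erase_of_mem (by simp [hxy.symm, hy]), Finset.card_erase_of_mem hx]; omega)
    refine ⟨fun z => if z = x then y else if z = y then x else σ z, ?_⟩
    intro z hz
    have := hσ z
    simp only [Finset.mem_erase] at this
    by_cases h1 : z = x
    · subst h1; simp [hy, hxy.symm]
    · by_cases h2 : z = y
      · subst h2; simp [hx, hxy, hxy.symm]
      · have := this ⟨h2, h1, hz⟩
        simp [h1, h2, this]

lemma gdeg_finset {α : Type*} (K : SimpleGraph α) (x : α) (N : Finset α)
    (h : ∀ y, K.Adj x y ↔ y ∈ N) : gdeg K x = N.card := by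
  unfold gdeg
  rw [← Set.ncard_coe_finset]
  congr 1
  ext y; simp [h]

lemma starK {α : Type*} (S T : Finset α) (hT : T ⊆ S) (hev : Even T.card) (hne : S.Nonempty)
    (hex : ¬ (S.card = 2 ∧ T = ∅)) :
    ∃ K : SimpleGraph α, (∀ x y, K.Adj x y → x ∈ S) ∧
      (∀ A : Set α, (∃ a ∈ S, a ∈ A) → (∃ b ∈ S, b ∉ A) → ∃ a ∈ A, ∃ b, b ∉ A ∧ K.Adj a b) ∧
      ∀ x, Odd (gdeg K x) ↔ x ∈ T := by
  classical
  by_cases hc : ∃ c ∈ S, Even ((S.erase c \ T).card)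
  · obtain ⟨c, hcS, hU⟩ := hc
    set U := S.erase c \ T with hUdef
    obtain ⟨n, hn⟩ := hU
    obtain ⟨σ, hσ⟩ := exists_match n U (by omega)
    have hUm : ∀ x, x ∈ U ↔ (x ≠ c ∧ x ∈ S) ∧ x ∉ T := by
      intro x; simp [hUdef]
    let K : SimpleGraph α :=
      { Adj := fun x y => x ≠ y ∧ x ∈ S ∧ y ∈ S ∧ (x = c ∨ y = c ∨ (x ∈ U ∧ y = σ x))
        symm := ⟨by
          rintro x y ⟨h1, h2, h3, h4⟩
          refine ⟨h1.symm, h3, h2, ?_⟩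
          rcases h4 with h | h | ⟨h, rfl⟩
          · exact Or.inr (Or.inl h)
          · exact Or.inl h
          · exact Or.inr (Or.inr ⟨(hσ x h).1, (hσ x h).2.2.symm⟩)⟩
        loopless := ⟨fun x h => h.1 rfl⟩ }
    have hK : ∀ x y, K.Adj x y ↔ x ≠ y ∧ x ∈ S ∧ y ∈ S ∧ (x = c ∨ y = c ∨ (x ∈ U ∧ y = σ x)) :=
      fun x y => Iff.rfl
    refine ⟨K, fun x y h => h.2.1, ?_, ?_⟩
    · rintro A ⟨a, ha, haA⟩ ⟨b, hb, hbA⟩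
      by_cases hcA : c ∈ A
      · exact ⟨c, hcA, b, hbA, by rintro rfl; exact hbA hcA, hcS, hb, Or.inl rfl⟩
      · exact ⟨a, haA, c, hcA, by rintro rfl; exact hcA haA, ha, hcS, Or.inr (Or.inl rfl)⟩
    · intro x
      by_cases hxS : x ∈ S
      · by_cases hxc : x = c
        · subst hxc
          rw [gdeg_finset K x (S.erase x) (by
            intro y; rw [hK, Finset.mem_erase]
            constructor
            · rintro ⟨h1, h2, h3, -⟩; exact ⟨h1.symm, h3⟩
            · rintro ⟨h1, h2⟩; exact ⟨h1.symm, hxS, h2, Or.inl rfl⟩)]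
          have h1 : (S.erase x).card = U.card + (T.erase x).card := by
            rw [← Finset.card_sdiff_add_card_inter (S.erase x) T]
            congr 2
            ext y; simp only [Finset.mem_inter, Finset.mem_erase]
            constructor
            · rintro ⟨⟨h1, h2⟩, h3⟩; exact ⟨h1, h3⟩
            · rintro ⟨h1, h2⟩; exact ⟨⟨h1, hT h2⟩, h2⟩
          rw [h1]
          by_cases hxT : x ∈ T
          · have := Finset.card_erase_add_one hxT
            simp only [hxT, iff_true]
            obtain ⟨m, hm⟩ := hev
            exact ⟨n + m - 1, by omega⟩
          · rw [Finset.erase_eq_of_notMem hxT]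
            simp only [hxT, iff_false, Nat.not_odd_iff_even]
            exact Even.add ⟨n, hn⟩ hev
        · by_cases hxU : x ∈ U
          · rw [gdeg_finset K x {c, σ x} (by
              intro y; rw [hK, Finset.mem_insert, Finset.mem_singleton]
              have h1 := hσ x hxU
              have h2 := (hUm _).1 h1.1
              constructor
              · rintro ⟨_, _, _, h⟩; tauto
              · rintro (rfl | rfl)
                · exact ⟨hxc, hxS, hcS, Or.inr (Or.inl rfl)⟩
                · exact ⟨h1.2.1.symm, hxS, h2.1.2, Or.inr (Or.inr ⟨hxU, rfl⟩)⟩)]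
            have h2 := (hUm _).1 (hσ x hxU).1
            rw [Finset.card_pair h2.1.1.symm]
            have := (hUm x).1 hxU
            simp only [this.2, iff_false]
            decide
          · rw [gdeg_finset K x {c} (by
              intro y; rw [hK, Finset.mem_singleton]
              constructor
              · rintro ⟨_, _, _, h⟩; tauto
              · rintro rfl
                exact ⟨hxc, hxS, hcS, Or.inr (Or.inl rfl)⟩)]
            have : x ∈ T := by
              by_contra h; exact hxU ((hUm x).2 ⟨⟨hxc, hxS⟩, h⟩)
            simp [this]
      · rw [gdeg_finset K x ∅ (by intro y; rw [hK]; simp [hxS])]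
        simp only [Finset.card_empty]
        have : x ∉ T := fun h => hxS (hT h)
        simp [this]
  · push Not at hc
    have key : ∀ c ∈ S, (S.erase c \ T).card + (T.erase c).card + 1 = S.card := by
      intro c hcS
      rw [← Finset.card_erase_add_one hcS, ← Finset.card_sdiff_add_card_inter (S.erase c) T]
      congr 3
      ext y; simp only [Finset.mem_inter, Finset.mem_erase]
      constructor
      · rintro ⟨h1, h2⟩; exact ⟨⟨h1, hT h2⟩, h2⟩
      · rintro ⟨⟨h1, h2⟩, h3⟩; exact ⟨h1, h3⟩
    have hTe : T = ∅ := by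
      rw [Finset.eq_empty_iff_forall_notMem]
      intro t ht
      have h1 := key t (hT ht)
      have h2 := Nat.not_even_iff_odd.1 (hc t (hT ht))
      have h3 := Finset.card_erase_add_one ht
      have hS : Odd S.card := by
        obtain ⟨a, ha⟩ := h2
        obtain ⟨b, hb⟩ := hev
        exact ⟨a + b, by omega⟩
      have hST : T ≠ S := by
        rintro rfl; exact Nat.not_even_iff_odd.2 hS hev
      obtain ⟨c, hcS, hcT⟩ := Finset.exists_of_ssubset (Finset.ssubset_iff_subset_ne.2 ⟨hT, hST⟩)
      have h4 := key c hcS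
      rw [Finset.erase_eq_of_notMem hcT] at h4
      have h5 := Nat.not_even_iff_odd.1 (hc c hcS)
      obtain ⟨a, ha⟩ := h5
      obtain ⟨b, hb⟩ := hev
      obtain ⟨d, hd⟩ := hS
      omega
    subst hTe
    obtain ⟨c, hcS⟩ := hne
    have h1 := key c hcS
    have h2 := Nat.not_even_iff_odd.1 (hc c hcS)
    have hSe : Even S.card := by
      obtain ⟨a, ha⟩ := h2
      exact ⟨a + 1, by simp at h1; simp at ha; omega⟩
    have hS2 : S.card ≠ 2 := fun h => hex ⟨h, rfl⟩
    have hS4 : 4 ≤ S.card := by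
      obtain ⟨b, hb⟩ := hSe
      have : 0 < S.card := Finset.card_pos.2 ⟨c, hcS⟩
      omega
    obtain ⟨d, hd⟩ : (S.erase c).Nonempty := by
      rw [← Finset.card_pos, Finset.card_erase_of_mem hcS]; omega
    have hdc : d ≠ c := Finset.ne_of_mem_erase hd
    have hdS : d ∈ S := Finset.mem_of_mem_erase hd
    have hcard : ((S.erase c).erase d).card = S.card - 2 := by
      rw [Finset.card_erase_of_mem hd, Finset.card_erase_of_mem hcS]; omega
    obtain ⟨m, hm⟩ : ((S.erase c).erase d).Nonempty := by
      rw [← Finset.card_pos, hcard]; omega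
    simp only [Finset.mem_erase] at hm
    let K : SimpleGraph α :=
      { Adj := fun x y => x ∈ S ∧ y ∈ S ∧ ¬ ((x = c ∨ x = d) ↔ (y = c ∨ y = d))
        symm := ⟨by rintro x y ⟨h1, h2, h3⟩; exact ⟨h2, h1, fun h => h3 h.symm⟩⟩
        loopless := ⟨fun x h => h.2.2 Iff.rfl⟩ }
    have hK : ∀ x y, K.Adj x y ↔ x ∈ S ∧ y ∈ S ∧ ¬ ((x = c ∨ x = d) ↔ (y = c ∨ y = d)) :=
      fun x y => Iff.rfl
    refine ⟨K, fun x y h => h.1, ?_, ?_⟩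
    · rintro A ⟨a, ha, haA⟩ ⟨b, hb, hbA⟩
      by_cases hab : (a = c ∨ a = d) ↔ (b = c ∨ b = d)
      · by_cases ha' : a = c ∨ a = d
        · by_cases hmA : m ∈ A
          · refine ⟨m, hmA, b, hbA, (hK _ _).2 ⟨hm.2.2, hb, ?_⟩⟩
            tauto
          · refine ⟨a, haA, m, hmA, (hK _ _).2 ⟨ha, hm.2.2, ?_⟩⟩
            tauto
        · by_cases hcA : c ∈ A
          · refine ⟨c, hcA, b, hbA, (hK _ _).2 ⟨hcS, hb, ?_⟩⟩
            tauto
          · refine ⟨a, haA, c, hcA, (hK _ _).2 ⟨ha, hcS, ?_⟩⟩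
            tauto
      · exact ⟨a, haA, b, hbA, (hK _ _).2 ⟨ha, hb, hab⟩⟩
    · intro x
      simp only [Finset.notMem_empty, iff_false, Nat.not_odd_iff_even]
      by_cases hxS : x ∈ S
      · by_cases hx : x = c ∨ x = d
        · rw [gdeg_finset K x ((S.erase c).erase d) (by
            intro y; rw [hK]; simp only [Finset.mem_erase]; tauto), hcard]
          obtain ⟨b, hb⟩ := hSe
          exact ⟨b - 1, by omega⟩
        · rw [gdeg_finset K x {c, d} (by
            intro y; rw [hK]; simp only [Finset.mem_insert, Finset.mem_singleton]
            constructor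
            · tauto
            · rintro (rfl | rfl)
              · tauto
              · tauto), Finset.card_pair hdc.symm]
          decide
      · rw [gdeg_finset K x ∅ (by intro y; rw [hK]; simp [hxS])]
        simp

lemma gdeg_split {V : Type*} [Finite V] {G : SimpleGraph V} (K : V → SimpleGraph G.edgeSet)
    (hK : ∀ v e f, (K v).Adj e f → v ∈ e.1) (F : SimpleGraph G.edgeSet)
    (hF : ∀ e f, F.Adj e f ↔ ∃ v, (K v).Adj e f) (e : G.edgeSet) (u v : V) (he : e.1 = s(u, v)) :
    gdeg F e = gdeg (K u) e + gdeg (K v) e := by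
  unfold gdeg
  have huv : u ≠ v := by
    have := e.2; rw [he] at this; exact this.ne
  rw [← Set.ncard_union_eq]
  · congr 1
    ext f
    simp only [mem_neighborSet, Set.mem_union, hF]
    constructor
    · rintro ⟨x, hx⟩
      have := hK x e f hx
      rw [he, Sym2.mem_iff] at this
      rcases this with rfl | rfl
      · exact Or.inl hx
      · exact Or.inr hx
    · rintro (h | h)
      · exact ⟨_, h⟩
      · exact ⟨_, h⟩
  · rw [Set.disjoint_left]
    intro f h1 h2
    simp only [mem_neighborSet] at h1 h2
    have a1 := hK _ _ _ h1.symm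
    have a2 := hK _ _ _ h2.symm
    have : f = e := by
      apply Subtype.ext
      rw [he]
      exact (Sym2.mem_and_mem_iff huv).1 ⟨a1, a2⟩
    exact h1.ne this.symm

lemma sdeg_eq_edges {V : Type*} {G : SimpleGraph V} (H : G.Subgraph) (v : V) :
    sdeg H v = {e : G.edgeSet | e.1 ∈ H.edgeSet ∧ v ∈ e.1}.ncard := by
  have h1 : sdeg H v = gdeg H.spanningCoe v := rfl
  rw [h1, gdeg_eq_edges, ← Set.ncard_image_of_injective _ Subtype.val_injective]
  congr 1
  ext e
  simp only [Set.mem_image, Set.mem_ofPred_eq, Subtype.exists, exists_and_right, exists_eq_right]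
  constructor
  · rintro ⟨h2, h3⟩
    have h2' : e ∈ H.edgeSet := by simpa using h2
    exact ⟨⟨H.edgeSet_subset h2', h2'⟩, h3⟩
  · rintro ⟨⟨h2, h3⟩, h4⟩
    exact ⟨by simpa using h3, h4⟩

/-- cut property of a connected graph -/
lemma conn_cut {V : Type*} {G : SimpleGraph V} (hG : G.Connected) (A : Set V) (a b : V)
    (ha : a ∈ A) (hb : b ∉ A) : ∃ x ∈ A, ∃ y, y ∉ A ∧ G.Adj x y := by
  obtain ⟨p⟩ := hG.preconnected a b
  obtain ⟨d, -, h1, h2⟩ := p.exists_boundary_dart A ha hb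
  exact ⟨_, h1, _, h2, d.adj⟩

/-- condition (III) for `k = 2` in terms of vertex sets -/
lemma cond3_iff {V : Type*} {G : SimpleGraph V} (hG : G.Connected) (H : G.Subgraph) :
    (∀ H1 : G.Subgraph, H1 ≤ H → H1.verts.Nonempty → (H.verts \ H1.verts).Nonempty →
      ∃ a ∈ H1.verts, ∃ b ∈ H.verts \ H1.verts, G.dist a b ≤ 2 - 1) ↔
    ∀ A : Set V, (∃ a ∈ H.verts, a ∈ A) → (∃ b ∈ H.verts, b ∉ A) →
      ∃ a ∈ H.verts, a ∈ A ∧ ∃ b ∈ H.verts, b ∉ A ∧ G.Adj a b := by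
  constructor
  · rintro h A ⟨a, ha, haA⟩ ⟨b, hb, hbA⟩
    obtain ⟨x, hx, y, hy, hd⟩ := h
      { verts := H.verts ∩ A, Adj := fun _ _ => False, adj_sub := False.elim,
        edge_vert := False.elim, symm := ⟨fun _ _ h => h⟩ }
      ⟨Set.inter_subset_left, fun _ _ h => h.elim⟩ ⟨a, ha, haA⟩ ⟨b, hb, fun h => hbA h.2⟩
    have hyA : y ∉ A := fun h => hy.2 ⟨hy.1, h⟩
    refine ⟨x, hx.1, hx.2, y, hy.1, hyA, ?_⟩
    rw [← dist_eq_one_iff_adj]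
    have : G.dist x y ≠ 0 := by
      intro h0
      rw [hG.dist_eq_zero_iff] at h0
      subst h0; exact hyA hx.2
    omega
  · rintro h H1 hle ⟨a, ha⟩ ⟨b, hb⟩
    obtain ⟨x, hx, hxA, y, hy, hyA, hxy⟩ := h H1.verts ⟨a, hle.1 ha, ha⟩ ⟨b, hb.1, hb.2⟩
    exact ⟨x, hxA, y, ⟨hy, hyA⟩, by rw [dist_eq_one_iff_adj.2 hxy]⟩

lemma gdeg_eq_edges' {V : Type*} (G : SimpleGraph V) (v : V) :
    gdeg G v = {e : G.edgeSet | v ∈ e.1}.ncard := by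
  rw [gdeg_eq_edges, ← Set.ncard_image_of_injective _ Subtype.val_injective]
  congr 1
  ext e
  simp [and_comm]

lemma gdeg_pos {V : Type*} [Finite V] {G : SimpleGraph V} {v w : V} (h : G.Adj v w) :
    0 < gdeg G v := by
  unfold gdeg
  rw [Set.ncard_pos]
  exact ⟨w, h⟩

lemma exists_of_gdeg_pos {V : Type*} {G : SimpleGraph V} {v : V} (h : 0 < gdeg G v) :
    ∃ w, G.Adj v w := by
  unfold gdeg at h
  exact Set.nonempty_of_ncard_ne_zero h.ne'

lemma two_edges {V : Type*} [Finite V] {G : SimpleGraph V} {v : V} (h : 2 ≤ gdeg G v) :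
    ∃ e f : G.edgeSet, e ≠ f ∧ v ∈ e.1 ∧ v ∈ f.1 := by
  rw [gdeg_eq_edges'] at h
  obtain ⟨e, f, he, hf, hne⟩ := (Set.one_lt_ncard_iff (Set.toFinite _)).1 h
  exact ⟨e, f, hne, he, hf⟩

lemma branch_int {V : Type*} {G : SimpleGraph V} {u v : V} {p : G.Walk u v} (hp : IsBranch G p)
    {i : ℕ} (h0 : 0 < i) (hi : i < p.length) : gdeg G (p.getVert i) = 2 := by
  obtain ⟨h1, -, -, -, h2⟩ := hp
  have inj := h1.getVert_injOn
  apply h2 _ (p.getVert_mem_support i)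
  · intro h
    have := inj (by simp; omega : i ∈ {i | i ≤ p.length}) (by simp : 0 ∈ {i | i ≤ p.length})
      (by simp [h])
    omega
  · intro h
    have := inj (by simp; omega : i ∈ {i | i ≤ p.length})
      (by simp : p.length ∈ {i | i ≤ p.length}) (by simp [h])
    omega

lemma IsBranch.reverse {V : Type*} {G : SimpleGraph V} {u v : V} {p : G.Walk u v}
    (hp : IsBranch G p) : IsBranch G p.reverse := by
  obtain ⟨h1, h2, h3, h4, h5⟩ := hp
  refine ⟨h1.reverse, by simpa using h2, h4, h3, ?_⟩
  intro w hw hwv hwu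
  exact h5 w (by simpa using hw) hwu hwv

lemma getVert_edge {V : Type*} {G : SimpleGraph V} {u v : V} (p : G.Walk u v) {i : ℕ}
    (hi : i < p.length) : s(p.getVert i, p.getVert (i + 1)) ∈ p.edges := by
  induction p generalizing i with
  | nil => simp at hi
  | cons h p ih =>
    cases i with
    | zero => simp
    | succ i =>
      simp only [Walk.length_cons] at hi
      have := ih (i := i) (by omega)
      simp [this]

/-- (⇒) main construction -/
lemma EUP_of_dom {V : Type*} [Finite V] {G : SimpleGraph V} (hG : G.Connected)
    {F : SimpleGraph G.edgeSet} {S : Set G.edgeSet} (hD : DomSub G.lineGraph F S)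
    (hz : ∃ z, 3 ≤ gdeg G z) : (EUP G 2).Nonempty := by
  classical
  have := Fintype.ofFinite V
  have := Fintype.ofFinite G.edgeSet
  let K : V → SimpleGraph G.edgeSet := fun v =>
    { Adj := fun e f => F.Adj e f ∧ v ∈ e.1 ∧ v ∈ f.1
      symm := ⟨fun e f h => ⟨h.1.symm, h.2.2, h.2.1⟩⟩
      loopless := ⟨fun e h => h.1.ne rfl⟩ }
  have hKadj : ∀ v e f, (K v).Adj e f ↔ F.Adj e f ∧ v ∈ e.1 ∧ v ∈ f.1 := fun _ _ _ => Iff.rfl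
  have hK : ∀ v e f, (K v).Adj e f → v ∈ e.1 := fun v e f h => h.2.1
  have hF : ∀ e f, F.Adj e f ↔ ∃ v, (K v).Adj e f := by
    intro e f
    constructor
    · intro h
      obtain ⟨-, v, h1, h2⟩ := lineGraph_adj_iff_exists.1 (hD.le h)
      exact ⟨v, h, h1, h2⟩
    · rintro ⟨v, h⟩; exact h.1
  let od : V → G.edgeSet → Prop := fun v e => Odd (gdeg (K v) e)
  have hodn : ∀ v e, od v e → ∃ f, (K v).Adj e f := by
    intro v e h
    apply exists_of_gdeg_pos
    exact Nat.pos_of_ne_zero (fun h0 => by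
      have h : Odd (gdeg (K v) e) := h
      rw [h0] at h; simp at h)
  have hodv : ∀ v e, od v e → v ∈ e.1 := by
    intro v e h; obtain ⟨f, hf⟩ := hodn v e h; exact hK _ _ _ hf
  have hodS : ∀ v e, od v e → e ∈ S := by
    intro v e h; obtain ⟨f, hf⟩ := hodn v e h; exact hD.mem _ _ hf.1
  -- f1
  have f1 : ∀ v e f, gdeg G v ≤ 2 → (K v).Adj e f → od v e := by
    intro v e f hv h
    have : gdeg (K v) e = 1 := by
      rw [gdeg_finset (K v) e {f}]
      · simp
      · intro g
        rw [Finset.mem_singleton]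
        constructor
        · intro hg
          by_contra hne
          rw [gdeg_eq_edges'] at hv
          have h3 : ({e, f, g} : Set G.edgeSet).ncard ≤ {e : G.edgeSet | v ∈ e.1}.ncard := by
            apply Set.ncard_le_ncard _ (Set.toFinite _)
            rintro x (rfl | rfl | rfl)
            · exact h.2.1
            · exact h.2.2
            · exact hg.2.2
          have h4 : ({e, f, g} : Set G.edgeSet).ncard = 3 := by
            rw [Set.ncard_eq_three]
            exact ⟨e, f, g, h.1.ne, hg.1.ne, fun h => hne h.symm, rfl⟩
          omega
        · rintro rfl; exact h
    show Odd (gdeg (K v) e)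
    rw [this]; exact odd_one
  -- f2
  have f2 : ∀ e ∈ S, (∀ v ∈ e.1, gdeg G v ≤ 2) → ∃ u, od u e := by
    intro e he hle
    by_cases hn : ∃ f, F.Adj e f
    · obtain ⟨f, hf⟩ := hn
      obtain ⟨v, hv⟩ := (hF e f).1 hf
      exact ⟨v, f1 v e f (hle v (hK _ _ _ hv)) hv⟩
    · exfalso
      obtain ⟨z, hz⟩ := hz
      obtain ⟨a, b, hab, ha, hb⟩ := two_edges (by omega : 2 ≤ gdeg G z)
      have hS : ∀ x ∈ S, z ∉ x.1 := by
        intro x hx hzx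
        have hxe : x ≠ e := by
          rintro rfl; have := hle z hzx; omega
        obtain ⟨c, hc, d, hd, hcd⟩ := hD.cut {e} ⟨e, he, rfl⟩ ⟨x, hx, hxe⟩
        rw [Set.mem_singleton_iff] at hc
        subst hc
        exact hn ⟨d, hcd⟩
      rcases hD.dom a b (lineGraph_adj_iff_exists.2 ⟨hab, z, ha, hb⟩) with h | h
      · exact hS _ h ha
      · exact hS _ h hb
  let H : G.Subgraph :=
    { verts := {v | 3 ≤ gdeg G v ∨ ∃ e : G.edgeSet, v ∈ e.1 ∧ ∃ u, od u e}
      Adj := fun x y => ∃ h : G.Adj x y, ∃ u, od u ⟨s(x, y), h⟩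
      adj_sub := fun h => h.1
      edge_vert := by
        rintro x y ⟨h, u, hu⟩
        exact Or.inr ⟨⟨s(x, y), h⟩, by simp, u, hu⟩
      symm := ⟨by
        rintro x y ⟨h, u, hu⟩
        refine ⟨h.symm, u, ?_⟩
        convert hu using 2
        exact Subtype.ext Sym2.eq_swap⟩ }
  have hHe : ∀ e : G.edgeSet, e.1 ∈ H.edgeSet ↔ ∃ u, od u e := by
    rintro ⟨e, he⟩
    induction e with
    | _ x y =>
      rw [Subgraph.mem_edgeSet]
      exact ⟨fun h => h.2, fun h => ⟨he, h⟩⟩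
  have hHv : ∀ v, v ∈ H.verts ↔ 3 ≤ gdeg G v ∨ ∃ e : G.edgeSet, v ∈ e.1 ∧ ∃ u, od u e :=
    fun v => Iff.rfl
  -- key branch contradiction
  have hbr : ∀ (u v : V) (p : G.Walk u v), IsBranch G p → (∀ e ∈ p.edges, e ∉ H.edgeSet) →
      ∀ i, i + 2 ≤ p.length → gdeg G (p.getVert i) ≤ 2 → gdeg G (p.getVert (i + 1)) ≤ 2 →
      gdeg G (p.getVert (i + 2)) ≤ 2 → False := by
    intro u v p hp hdis i hi g0 g1 g2
    have e1 := getVert_edge p (i := i) (by omega)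
    have e2 := getVert_edge p (i := i + 1) (by omega)
    let a : G.edgeSet := ⟨_, p.edges_subset_edgeSet e1⟩
    let b : G.edgeSet := ⟨_, p.edges_subset_edgeSet e2⟩
    have hab : a ≠ b := by
      intro h
      have h' := congrArg Subtype.val h
      simp only [a, b, Sym2.eq_iff] at h'
      have inj := hp.1.getVert_injOn
      have h02 : p.getVert i ≠ p.getVert (i + 2) := by
        intro hh
        have := inj (by simp; omega : i ∈ {i | i ≤ p.length})
          (by simp; omega : i + 2 ∈ {i | i ≤ p.length}) hh
        omega
      have h01 : p.getVert i ≠ p.getVert (i + 1) := (p.adj_of_mem_edges e1).ne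
      rcases h' with h' | h'
      · exact h01 h'.1
      · exact h02 h'.1
    have ha2 : ∀ v ∈ a.1, gdeg G v ≤ 2 := by
      intro v hv
      simp only [a, Sym2.mem_iff] at hv
      rcases hv with rfl | rfl <;> assumption
    have hb2 : ∀ v ∈ b.1, gdeg G v ≤ 2 := by
      intro v hv
      simp only [b, Sym2.mem_iff] at hv
      rcases hv with rfl | rfl <;> assumption
    rcases hD.dom a b (lineGraph_adj_iff_exists.2 ⟨hab, p.getVert (i + 1), by simp [a], by simp [b]⟩) with h | h
    · exact hdis _ e1 ((hHe a).2 (f2 a h ha2))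
    · exact hdis _ e2 ((hHe b).2 (f2 b h hb2))
  refine ⟨H, ?_, ?_, fun v hv => Or.inl hv, ?_, ?_, ?_⟩
  · -- parity
    have hex : ∀ v, Odd (sdeg H v) → ∃ e : G.edgeSet, v ∈ e.1 ∧ ¬ od v e ∧ ∃ u, od u e := by
      intro v hv
      by_contra hcon
      push Not at hcon
      have : {e : G.edgeSet | e.1 ∈ H.edgeSet ∧ v ∈ e.1} = {e | od v e} := by
        ext e
        simp only [Set.mem_ofPred_eq, hHe]
        constructor
        · rintro ⟨⟨u, hu⟩, hv⟩
          by_contra hn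
          exact hcon e hv hn u hu
        · exact fun h => ⟨⟨v, h⟩, hodv v e h⟩
      rw [sdeg_eq_edges, this] at hv
      have hev := (K v).even_card_odd_degree_vertices
      have hcard : {e | od v e}.ncard = (Finset.univ.filter fun e => Odd ((K v).degree e)).card := by
        rw [← Set.ncard_coe_finset]
        congr 1
        ext e
        have : gdeg (K v) e = (K v).degree e := by
          rw [gdeg_finset (K v) e ((K v).neighborFinset e) (by simp)]; rfl
        simp [od, this]
      rw [hcard] at hv
      exact Nat.not_even_iff_odd.2 hv (by convert hev)
    have : Nonempty G.edgeSet := ⟨hD.ne.some⟩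
    choose! g hg1 hg2 hg3 using hex
    refine le_trans (Set.ncard_le_ncard_of_injOn g ?_ ?_ (Set.toFinite _)) hD.odd
    · intro v hv
      obtain ⟨u, hu⟩ := hg3 v hv
      have huv : u ≠ v := by rintro rfl; exact hg2 _ hv hu
      have he : (g v).1 = s(u, v) := (Sym2.mem_and_mem_iff huv).1 ⟨hodv _ _ hu, hg1 v hv⟩
      show Odd (gdeg F (g v))
      rw [gdeg_split K hK F hF (g v) u v he]
      exact Odd.add_even hu (Nat.not_odd_iff_even.1 (hg2 v hv))
    · intro v hv v' hv' heq
      by_contra hne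
      obtain ⟨u, hu⟩ := hg3 v hv
      have huv : u ≠ v := by rintro rfl; exact hg2 _ hv hu
      have huv' : u ≠ v' := by rintro rfl; rw [heq] at hu; exact hg2 _ hv' hu
      have he : (g v).1 = s(u, v) := (Sym2.mem_and_mem_iff huv).1 ⟨hodv _ _ hu, hg1 v hv⟩
      have := hg1 v' hv'
      rw [← heq, he, Sym2.mem_iff] at this
      rcases this with h | h
      · exact huv' h.symm
      · exact hne h.symm
  · intro v hv hiso
    rcases hv with hv | ⟨e, hve, hu⟩
    · exact hv
    · exfalso
      obtain ⟨w, hw⟩ := hve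
      have h1 := (hHe e).2 hu
      rw [hw, Subgraph.mem_edgeSet] at h1
      have : w ∈ H.neighborSet v := h1
      rw [hiso] at this
      exact this
  · rw [cond3_iff hG]
    rintro A ⟨a, ha, haA⟩ ⟨b, hb, hbA⟩
    by_contra hcon
    have hno : ∀ x y, x ∈ H.verts → x ∈ A → y ∈ H.verts → y ∉ A → ∀ e : G.edgeSet,
        x ∈ e.1 → y ∈ e.1 → False := by
      intro x y hx hxA hy hyA e hxe hye
      have hxy : x ≠ y := by rintro rfl; exact hyA hxA
      have he : e.1 = s(x, y) := (Sym2.mem_and_mem_iff hxy).1 ⟨hxe, hye⟩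
      have := e.2
      rw [he] at this
      exact hcon ⟨x, hx, hxA, y, hy, hyA, this⟩
    have f3 : ∀ v ∈ H.verts, ∃ e ∈ S, v ∈ e.1 := by
      rintro v (hv | ⟨e, hve, u, hu⟩)
      · obtain ⟨e, f, hef, he, hf⟩ := two_edges (by omega : 2 ≤ gdeg G v)
        rcases hD.dom e f (lineGraph_adj_iff_exists.2 ⟨hef, v, he, hf⟩) with h | h
        · exact ⟨e, h, he⟩
        · exact ⟨f, h, hf⟩
      · exact ⟨e, hodS _ _ hu, hve⟩
    obtain ⟨ea, heaS, hea⟩ := f3 a ha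
    obtain ⟨eb, hebS, heb⟩ := f3 b hb
    obtain ⟨e, ⟨x, hxe, hxH, hxA⟩, f, hf, hef⟩ := hD.cut {e | ∃ x ∈ e.1, x ∈ H.verts ∧ x ∈ A}
      ⟨ea, heaS, a, hea, ha, haA⟩
      ⟨eb, hebS, by
        rintro ⟨x, hx, hxH, hxA⟩
        exact hno x b hxH hxA hb hbA eb hx heb⟩
    obtain ⟨v, hv⟩ := (hF e f).1 hef
    have hvH : v ∈ H.verts := by
      by_cases h : 3 ≤ gdeg G v
      · exact Or.inl h
      · exact Or.inr ⟨e, hv.2.1, v, f1 v e f (by omega) hv⟩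
    have hvA : v ∉ A := fun h => hf ⟨v, hv.2.2, hvH, h⟩
    exact hno x v hxH hxA hvH hvA e hxe hv.2.1
  · intro u v p hp hdis
    by_contra hlen
    exact hbr u v p hp hdis 1 (by omega) (branch_int hp (by omega) (by omega)).le
      (branch_int hp (by omega) (by omega)).le (branch_int hp (by omega) (by omega)).le
  · rintro u v p hp ⟨w, hw, hw1⟩ hdis
    by_contra hlen
    have hends : w = u ∨ w = v := by
      by_contra h
      push Not at h
      have := hp.2.2.2.2 w hw h.1 h.2
      omega
    rcases hends with rfl | rfl
    · exact hbr w v p hp hdis 0 (by omega) (by simp [hw1])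
        (branch_int hp (by omega) (by omega)).le (branch_int hp (by omega) (by omega)).le
    · have hl : p.reverse.length = p.length := by simp
      exact hbr w u p.reverse hp.reverse (by simpa using hdis) 0 (by omega) (by simp [hw1])
        (branch_int hp.reverse (by omega) (by omega)).le
        (branch_int hp.reverse (by omega) (by omega)).le

lemma card_le_gdeg {V : Type*} [Finite V] {G : SimpleGraph V} {v : V} (N : Finset V)
    (h : ∀ y ∈ N, G.Adj v y) : N.card ≤ gdeg G v := by
  unfold gdeg
  rw [← Set.ncard_coe_finset]
  exact Set.ncard_le_ncard (fun y hy => h y hy) (Set.toFinite _)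

lemma top_EUP {V : Type*} [Finite V] {G : SimpleGraph V} (hG : G.Connected) [Nontrivial V]
    (h2 : ∀ v, gdeg G v ≤ 2) : (⊤ : G.Subgraph) ∈ EUP G 2 := by
  classical
  have := Fintype.ofFinite V
  have hpos : ∀ v, ∃ w, G.Adj v w := by
    intro v
    obtain ⟨w, hw⟩ := exists_ne v
    obtain ⟨x, hx, y, -, hxy⟩ := conn_cut hG {v} v w rfl hw
    rw [Set.mem_singleton_iff] at hx
    subst hx
    exact ⟨y, hxy⟩
  have hedge : ∀ (u v : V) (p : G.Walk u v), 0 < p.length →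
      (∀ e ∈ p.edges, e ∉ (⊤ : G.Subgraph).edgeSet) → False := by
    intro u v p hl h
    have h1 := getVert_edge p (i := 0) hl
    exact h _ h1 (by simpa using p.edges_subset_edgeSet h1)
  refine ⟨?_, ?_, fun v _ => by simp, ?_, ?_, ?_⟩
  · have hdeg : ∀ v, sdeg (⊤ : G.Subgraph) v = G.degree v := by
      intro v
      have : sdeg (⊤ : G.Subgraph) v = gdeg G v := by
        unfold sdeg gdeg; congr 1
      rw [this, gdeg_finset G v (G.neighborFinset v) (by simp)]; rfl
    have hgd : ∀ v, G.degree v = gdeg G v := by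
      intro v
      rw [gdeg_finset G v (G.neighborFinset v) (by simp)]; rfl
    have hset : {v | Odd (sdeg (⊤ : G.Subgraph) v)} =
        ((Finset.univ.filter fun v => Odd (G.degree v) : Finset V) : Set V) := by
      ext v; simp [hdeg]
    rw [hset, Set.ncard_coe_finset]
    have hsum := G.sum_degrees_eq_twice_card_edges
    have hc := hG.card_vert_le_card_edgeSet_add_one
    rw [Nat.card_eq_fintype_card, Nat.card_eq_fintype_card, ← edgeFinset_card] at hc
    have hs2 : ∑ v, (G.degree v + if Odd (G.degree v) then 1 else 0) = ∑ v : V, 2 := by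
      apply Finset.sum_congr rfl
      intro v _
      have h1 := h2 v
      rw [← hgd] at h1
      obtain ⟨w, hw⟩ := hpos v
      have h3 := gdeg_pos hw
      rw [← hgd] at h3
      have h4 : G.degree v = 1 ∨ G.degree v = 2 := by omega
      rcases h4 with h4 | h4 <;> rw [h4] <;> decide
    rw [Finset.sum_add_distrib, hsum, ← Finset.card_filter] at hs2
    simp at hs2
    omega
  · intro v _ hiso
    obtain ⟨w, hw⟩ := hpos v
    have : w ∈ (⊤ : G.Subgraph).neighborSet v := by simpa using hw
    rw [hiso] at this
    exact this.elim
  · rw [cond3_iff hG]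
    rintro A ⟨a, -, ha⟩ ⟨b, -, hb⟩
    obtain ⟨x, hx, y, hy, hxy⟩ := conn_cut hG A a b ha hb
    exact ⟨x, by simp, hx, y, by simp, hy, hxy⟩
  · intro u v p hp h; exact (hedge u v p hp.2.1 h).elim
  · intro u v p hp _ h; exact (hedge u v p hp.2.1 h).elim

lemma sub_cut {V : Type*} {G : SimpleGraph V} {K : G.Subgraph} (hK : K.Connected) (A : Set V)
    {a b : V} (ha : a ∈ K.verts) (hb : b ∈ K.verts) (haA : a ∈ A) (hbA : b ∉ A) :
    ∃ x ∈ A, ∃ y, y ∉ A ∧ K.Adj x y := by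
  obtain ⟨x, hx, y, hy, hxy⟩ := conn_cut hK.coe {v : K.verts | v.1 ∈ A} ⟨a, ha⟩ ⟨b, hb⟩ haA hbA
  exact ⟨x, hx, y, hy, hxy⟩

lemma sdeg_sup {V : Type*} [Finite V] {G : SimpleGraph V} (H K : G.Subgraph)
    (hd : ∀ e ∈ K.edgeSet, e ∉ H.edgeSet) (x : V) :
    sdeg (H ⊔ K) x = sdeg H x + {e | e ∈ K.edgeSet ∧ x ∈ e}.ncard := by
  have h1 : ∀ L : G.Subgraph, sdeg L x = {e | e ∈ L.edgeSet ∧ x ∈ e}.ncard := by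
    intro L
    have h1 : sdeg L x = gdeg L.spanningCoe x := rfl
    rw [h1, gdeg_eq_edges]
    simp
  rw [h1, h1, ← Set.ncard_union_eq]
  · congr 1
    ext e
    simp only [Subgraph.edgeSet_sup, Set.mem_union, Set.mem_ofPred_eq]
    tauto
  · rw [Set.disjoint_left]
    intro e he he'
    exact hd e he'.1 he.1

/-- extension of a member of `EUP` by a trail -/
lemma EUP_add {V : Type*} [Finite V] {G : SimpleGraph V} (hG : G.Connected) {H : G.Subgraph}
    (hH : H ∈ EUP G 2) {a b : V} (c : G.Walk a b) (hlen : 0 < c.length)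
    (hd : ∀ e ∈ c.edges, e ∉ H.edgeSet) (hm : ∃ x ∈ c.support, x ∈ H.verts)
    (hodd : {x | Odd (sdeg H x + {e | e ∈ c.edges ∧ x ∈ e}.ncard)}.ncard ≤ 2) :
    H ⊔ c.toSubgraph ∈ EUP G 2 := by
  obtain ⟨h1, h2, h3, h4, h5, h6⟩ := hH
  rw [cond3_iff hG] at h4
  have hce : ∀ e, e ∈ c.toSubgraph.edgeSet ↔ e ∈ c.edges := by
    intro e; simp
  have hcv : ∀ v, v ∈ c.toSubgraph.verts ↔ v ∈ c.support := by
    intro v; simp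
  have hconn := c.toSubgraph_connected
  refine ⟨?_, ?_, ?_, ?_, ?_, ?_⟩
  · convert hodd using 5 with x
    rw [sdeg_sup H c.toSubgraph (fun e he => hd e ((hce e).1 he))]
    simp only [hce]
  · intro v hv hiso
    rw [Subgraph.neighborSet_sup, Set.union_empty_iff] at hiso
    rw [Subgraph.verts_sup] at hv
    rcases hv with hv | hv
    · exact h2 v hv hiso.1
    · exfalso
      have hadj := c.adj_getVert_succ hlen
      have : ∃ w ∈ c.toSubgraph.verts, w ≠ v := by
        by_cases hw : c.getVert 0 = v
        · refine ⟨c.getVert 1, (hcv _).2 (c.getVert_mem_support _), ?_⟩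
          rw [← hw]; exact hadj.ne.symm
        · exact ⟨c.getVert 0, (hcv _).2 (c.getVert_mem_support _), hw⟩
      obtain ⟨w, hw, hwv⟩ := this
      obtain ⟨x, hx, y, -, hxy⟩ := sub_cut hconn {v} hv hw rfl hwv
      rw [Set.mem_singleton_iff] at hx
      subst hx
      have : y ∈ c.toSubgraph.neighborSet x := hxy
      rw [hiso.2] at this
      exact this
  · intro v hv; exact Or.inl (h3 v hv)
  · rw [cond3_iff hG]
    rintro A ⟨x, hx, hxA⟩ ⟨y, hy, hyA⟩
    by_cases hs : (∃ a ∈ H.verts, a ∈ A) ∧ (∃ b ∈ H.verts, b ∉ A)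
    · obtain ⟨p, hp, hpA, q, hq, hqA, hpq⟩ := h4 A hs.1 hs.2
      exact ⟨p, Or.inl hp, hpA, q, Or.inl hq, hqA, hpq⟩
    · obtain ⟨m, hmc, hmH⟩ := hm
      rw [Subgraph.verts_sup] at hx hy
      have hmc' := (hcv m).2 hmc
      have : (∃ a ∈ c.toSubgraph.verts, a ∈ A) ∧ (∃ b ∈ c.toSubgraph.verts, b ∉ A) := by
        by_cases hmA : m ∈ A
        · refine ⟨⟨m, hmc', hmA⟩, ?_⟩
          rcases hy with hy | hy
          · exact absurd ⟨⟨m, hmH, hmA⟩, ⟨y, hy, hyA⟩⟩ hs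
          · exact ⟨y, hy, hyA⟩
        · refine ⟨?_, ⟨m, hmc', hmA⟩⟩
          rcases hx with hx | hx
          · exact absurd ⟨⟨x, hx, hxA⟩, ⟨m, hmH, hmA⟩⟩ hs
          · exact ⟨x, hx, hxA⟩
      obtain ⟨⟨p, hp, hpA⟩, ⟨q, hq, hqA⟩⟩ := this
      obtain ⟨s, hs, t, ht, hst⟩ := sub_cut hconn A hp hq hpA hqA
      exact ⟨s, Or.inr hst.fst_mem, hs, t, Or.inr hst.snd_mem, ht, hst.adj_sub⟩
  · intro u v p hp hdis
    exact h5 u v p hp (fun e he h => hdis e he (by rw [Subgraph.edgeSet_sup]; exact Or.inl h))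
  · intro u v p hp hw hdis
    exact h6 u v p hp hw (fun e he h => hdis e he (by rw [Subgraph.edgeSet_sup]; exact Or.inl h))

/-- `H` is a member of `EUP` with the maximum number of edges -/
def MaxEUP {V : Type*} (G : SimpleGraph V) (H : G.Subgraph) : Prop :=
  H ∈ EUP G 2 ∧ ∀ H' ∈ EUP G 2, H'.edgeSet.ncard ≤ H.edgeSet.ncard

lemma exists_max {V : Type*} [Finite V] {G : SimpleGraph V} (h : (EUP G 2).Nonempty) :
    ∃ H, MaxEUP G H := by
  obtain ⟨H, hH, hm⟩ := Set.exists_max_image (EUP G 2) (fun H => H.edgeSet.ncard)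
    (Set.toFinite _) h
  exact ⟨H, hH, hm⟩

lemma MaxEUP.no_add {V : Type*} [Finite V] {G : SimpleGraph V} (hG : G.Connected) {H : G.Subgraph}
    (hH : MaxEUP G H) {a b : V} (c : G.Walk a b) (hlen : 0 < c.length)
    (hd : ∀ e ∈ c.edges, e ∉ H.edgeSet) (hm : ∃ x ∈ c.support, x ∈ H.verts)
    (hodd : {x | Odd (sdeg H x + {e | e ∈ c.edges ∧ x ∈ e}.ncard)}.ncard ≤ 2) : False := by
  have h1 := hH.2 _ (EUP_add hG hH.1 c hlen hd hm hodd)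
  have h2 : H.edgeSet ⊂ (H ⊔ c.toSubgraph).edgeSet := by
    rw [Subgraph.edgeSet_sup]
    refine ⟨Set.subset_union_left, fun h => ?_⟩
    have he := getVert_edge c (i := 0) hlen
    exact hd _ he (h (Or.inr (by simpa using he)))
  have := Set.ncard_lt_ncard h2 (Set.toFinite _)
  omega

lemma MaxEUP.no_cycle {V : Type*} [Finite V] {G : SimpleGraph V} (hG : G.Connected)
    {H : G.Subgraph} (hH : MaxEUP G H) (hz : ∃ z, 3 ≤ gdeg G z) {a : V} (c : G.Walk a a)
    (hc : c.IsTrail) (hlen : 0 < c.length)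
    (hd : ∀ e ∈ c.edges, e ∉ H.edgeSet) : False := by
  have hev : ∀ x, Even ({e | e ∈ c.edges ∧ x ∈ e}.ncard) := by
    intro x; rw [trail_par hc]; exact fun h => absurd rfl h
  by_cases hm : ∃ x ∈ c.support, x ∈ H.verts
  · refine hH.no_add hG c hlen hd hm ?_
    refine le_trans (le_of_eq ?_) hH.1.1
    congr 1
    ext x
    simp only [Set.mem_ofPred_eq]
    rw [Nat.odd_add]
    simp [hev x]
  · push Not at hm
    obtain ⟨z, hz⟩ := hz
    have hzH := hH.1.2.2.1 z hz
    obtain ⟨x, hx, y, hy, hxy⟩ := conn_cut hG {v | v ∈ c.support} a z (by simp)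
      (fun h => hm z h hzH)
    have hx3 : ¬ 3 ≤ gdeg G x := fun h => hm x hx (hH.1.2.2.1 x h)
    apply hx3
    rw [gdeg_eq_edges]
    have hne : {e | e ∈ c.edges ∧ x ∈ e}.Nonempty := by
      have hxv : x ∈ c.toSubgraph.verts := by simpa using hx
      have hadj := c.adj_getVert_succ hlen
      have : ∃ w ∈ c.toSubgraph.verts, w ≠ x := by
        by_cases hw : c.getVert 0 = x
        · refine ⟨c.getVert 1, by simp, ?_⟩
          rw [← hw]; exact hadj.ne.symm
        · exact ⟨c.getVert 0, by simp, hw⟩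
      obtain ⟨w, hw, hwx⟩ := this
      obtain ⟨p, hp, q, -, hpq⟩ := sub_cut c.toSubgraph_connected {x} hxv hw rfl hwx
      rw [Set.mem_singleton_iff] at hp
      subst hp
      refine ⟨s(p, q), ?_, by simp⟩
      rw [← Subgraph.mem_edgeSet] at hpq
      simpa using hpq
    have h2 : 2 ≤ {e | e ∈ c.edges ∧ x ∈ e}.ncard := by
      have h0 := (Set.ncard_pos (Set.toFinite _)).2 hne
      obtain ⟨k, hk⟩ := hev x
      omega
    have hlt : {e | e ∈ c.edges ∧ x ∈ e} ⊂ {e | e ∈ G.edgeSet ∧ x ∈ e} := by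
      refine ⟨fun e he => ⟨c.edges_subset_edgeSet he.1, he.2⟩, fun h => ?_⟩
      have := (h ⟨hxy, by simp⟩ : s(x, y) ∈ {e | e ∈ c.edges ∧ x ∈ e}).1
      exact hy (c.snd_mem_support_of_mem_edges this)
    have := Set.ncard_lt_ncard hlt (Set.toFinite _)
    omega

lemma MaxEUP.full {V : Type*} [Finite V] {G : SimpleGraph V} (hG : G.Connected) {H : G.Subgraph}
    (hH : MaxEUP G H) {v : V} (hv : v ∈ H.verts) (h2 : gdeg G v = 2) {w : V} (hw : G.Adj v w) :
    H.Adj v w := by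
  by_contra hn
  have hs : sdeg H v = 1 := by
    have h1 : H.neighborSet v ⊂ G.neighborSet v :=
      ⟨H.neighborSet_subset v, fun h => hn (h hw)⟩
    have h3 := Set.ncard_lt_ncard h1 (Set.toFinite _)
    have h4 : (H.neighborSet v).Nonempty := by
      by_contra h
      rw [Set.not_nonempty_iff_eq_empty] at h
      have := hH.1.2.1 v hv h
      omega
    have h5 := (Set.ncard_pos (Set.toFinite _)).2 h4
    unfold gdeg at h2
    unfold sdeg
    omega
  have hct : (Walk.cons hw .nil : G.Walk v w).IsTrail := by simp
  refine hH.no_add hG (.cons hw .nil) (by simp) ?_ ⟨v, by simp, hv⟩ ?_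
  · intro e he
    simp only [Walk.edges_cons, Walk.edges_nil, List.mem_singleton] at he
    subst he
    rw [Subgraph.mem_edgeSet]; exact hn
  · have hpar := trail_par hct
    have hsub : {x | Odd (sdeg H x + {e | e ∈ (Walk.cons hw .nil : G.Walk v w).edges ∧
        x ∈ e}.ncard)} ⊆ insert w ({x | Odd (sdeg H x)} \ {v}) := by
      intro x hx
      have hx : Odd (sdeg H x + {e | e ∈ (Walk.cons hw .nil : G.Walk v w).edges ∧
        x ∈ e}.ncard) := hx
      rw [Nat.odd_add, hpar] at hx
      by_cases hxw : x = w
      · exact Or.inl hxw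
      · right
        by_cases hxv : x = v
        · subst hxv
          exfalso
          rw [hs] at hx
          exact (hx.1 odd_one hw.ne).1 rfl
        · exact ⟨hx.2 (fun _ => ⟨hxv, hxw⟩), hxv⟩
    refine (Set.ncard_le_ncard hsub (Set.toFinite _)).trans ?_
    refine (Set.ncard_insert_le _ _).trans ?_
    have hvo : v ∈ {x | Odd (sdeg H x)} := by
      show Odd (sdeg H v)
      rw [hs]; exact odd_one
    have := Set.ncard_sdiff_singleton_add_one hvo (Set.toFinite _)
    have := hH.1.1
    omega

lemma core {V : Type*} [Finite V] {G : SimpleGraph V} (hG : G.Connected) {H : G.Subgraph}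
    (hH : H ∈ EUP G 2) (hne : H.verts.Nonempty)
    (N1 : ∀ v ∈ H.verts, gdeg G v = 2 → ∀ w, G.Adj v w → H.Adj v w)
    (N2 : ∀ v, v ∉ H.verts → gdeg G v = 2 → ∃ u, G.Adj v u ∧ 3 ≤ gdeg G u)
    (hnb : ∀ v, ∃ w, G.Adj v w) : ∃ F S, DomSub G.lineGraph F S := by
  classical
  have := Fintype.ofFinite G.edgeSet
  obtain ⟨hodd, -, hall, hIII, -, -⟩ := hH
  rw [cond3_iff hG] at hIII
  have hT : ∀ v, ∃ (T : Finset G.edgeSet) (r : G.edgeSet),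
      (∀ e ∈ T, e.1 ∈ H.edgeSet ∧ v ∈ e.1) ∧ Even T.card ∧
      (∀ e : G.edgeSet, e.1 ∈ H.edgeSet → v ∈ e.1 → e ∉ T → e = r ∧ Odd (sdeg H v)) ∧
      (sdeg H v = 2 → T ≠ ∅) := by
    intro v
    obtain ⟨w, hw⟩ := hnb v
    set T0 : Finset G.edgeSet := Finset.univ.filter (fun e => e.1 ∈ H.edgeSet ∧ v ∈ e.1) with hT0
    have hc : sdeg H v = T0.card := by
      rw [sdeg_eq_edges, ← Set.ncard_coe_finset]
      congr 1
      ext e; simp [hT0]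
    rcases Nat.even_or_odd (sdeg H v) with he | ho
    · refine ⟨T0, ⟨s(v, w), hw⟩, fun e he => by simpa [hT0] using he, hc ▸ he, ?_, ?_⟩
      · intro e h1 h2 h3
        exact absurd (by simp [hT0, h1, h2]) h3
      · intro h2 h0
        rw [hc, h0] at h2; simp at h2
    · have hn : T0.Nonempty := by
        rw [← Finset.card_pos, ← hc]; exact ho.pos
      obtain ⟨r, hr⟩ := hn
      refine ⟨T0.erase r, r, fun e he => ?_, ?_, ?_, ?_⟩
      · simpa [hT0] using Finset.mem_of_mem_erase he
      · rw [Finset.card_erase_of_mem hr, ← hc]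
        exact Nat.Odd.sub_odd ho odd_one
      · intro e h1 h2 h3
        refine ⟨?_, ho⟩
        by_contra hne
        exact h3 (Finset.mem_erase.2 ⟨hne, by simp [hT0, h1, h2]⟩)
      · intro h2; rw [h2] at ho; exact absurd ho (by decide)
  choose T r hT1 hT2 hT3 hT4 using hT
  have hK : ∀ v, ∃ K : SimpleGraph G.edgeSet, (∀ e f, K.Adj e f → v ∈ e.1 ∧ v ∈ H.verts) ∧
      (v ∈ H.verts → ∀ A : Set G.edgeSet, (∃ a : G.edgeSet, v ∈ a.1 ∧ a ∈ A) →
        (∃ b : G.edgeSet, v ∈ b.1 ∧ b ∉ A) → ∃ a ∈ A, ∃ b, b ∉ A ∧ K.Adj a b) ∧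
      ∀ e, Odd (gdeg K e) ↔ e ∈ T v := by
    intro v
    by_cases hv : v ∈ H.verts
    · obtain ⟨w, hw⟩ := hnb v
      set S : Finset G.edgeSet := Finset.univ.filter (fun e => v ∈ e.1) with hS
      have hSm : ∀ e, e ∈ S ↔ v ∈ e.1 := by intro e; simp [hS]
      have hSc : gdeg G v = S.card := by
        rw [gdeg_eq_edges', ← Set.ncard_coe_finset]
        congr 1
        ext e; simp [hS]
      obtain ⟨K, k1, k2, k3⟩ := starK S (T v) (fun e he => (hSm e).2 (hT1 v e he).2) (hT2 v)
        ⟨⟨s(v, w), hw⟩, (hSm _).2 (by simp)⟩ (by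
          rintro ⟨h2, h0⟩
          refine hT4 v ?_ h0
          rw [← h2, ← hSc]
          have : H.neighborSet v = G.neighborSet v := by
            ext w
            exact ⟨fun h => H.adj_sub h, fun h => N1 v hv (hSc.trans h2) w h⟩
          unfold sdeg gdeg
          rw [this])
      refine ⟨K, fun e f h => ⟨(hSm e).1 (k1 e f h), hv⟩, ?_, k3⟩
      rintro - A ⟨a, ha, haA⟩ ⟨b, hb, hbA⟩
      exact k2 A ⟨a, (hSm a).2 ha, haA⟩ ⟨b, (hSm b).2 hb, hbA⟩
    · refine ⟨⊥, fun e f h => h.elim, fun h => absurd h hv, fun e => ?_⟩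
      have h0 : gdeg (⊥ : SimpleGraph G.edgeSet) e = 0 := by
        rw [gdeg_finset _ e ∅ (by simp)]; rfl
      rw [h0]
      constructor
      · intro h; exact absurd h (by decide)
      · intro h
        obtain ⟨h1, h2⟩ := hT1 v e h
        exact absurd (H.mem_verts_of_mem_edge h1 h2) hv
  choose K hK1 hK2 hK3 using hK
  let F : SimpleGraph G.edgeSet :=
    { Adj := fun e f => ∃ v, (K v).Adj e f
      symm := ⟨fun e f ⟨v, h⟩ => ⟨v, h.symm⟩⟩
      loopless := ⟨fun e ⟨v, h⟩ => h.ne rfl⟩ }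
  have hF : ∀ e f, F.Adj e f ↔ ∃ v, (K v).Adj e f := fun e f => Iff.rfl
  refine ⟨F, {e | ∃ v ∈ H.verts, v ∈ e.1}, ?_, ?_, ?_, ?_, ?_, ?_⟩
  · rintro e f ⟨v, h⟩
    rw [lineGraph_adj_iff_exists]
    exact ⟨h.ne, v, (hK1 v e f h).1, (hK1 v f e h.symm).1⟩
  · obtain ⟨v, hv⟩ := hne
    obtain ⟨w, hw⟩ := hnb v
    exact ⟨⟨s(v, w), hw⟩, v, hv, by simp⟩
  · rintro e f ⟨v, h⟩
    exact ⟨v, (hK1 v e f h).2, (hK1 v e f h).1⟩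
  · rintro A ⟨a, ⟨va, hva, hva'⟩, haA⟩ ⟨b, ⟨vb, hvb, hvb'⟩, hbA⟩
    have key : ∀ v ∈ H.verts, (∃ a : G.edgeSet, v ∈ a.1 ∧ a ∈ A) →
        (∃ b : G.edgeSet, v ∈ b.1 ∧ b ∉ A) → ∃ a ∈ A, ∃ b, b ∉ A ∧ F.Adj a b := by
      intro v hv h1 h2
      obtain ⟨a, ha, b, hb, h⟩ := hK2 v hv A h1 h2
      exact ⟨a, ha, b, hb, v, h⟩
    by_cases hb : ∃ e : G.edgeSet, vb ∈ e.1 ∧ e ∈ A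
    · exact key vb hvb hb ⟨b, hvb', hbA⟩
    · obtain ⟨x, hx, hxA, y, hy, hyA, hxy⟩ :=
        hIII {v | ∃ e : G.edgeSet, v ∈ e.1 ∧ e ∈ A} ⟨va, hva, a, hva', haA⟩ ⟨vb, hvb, hb⟩
      refine key x hx hxA ⟨⟨s(x, y), hxy⟩, by simp, fun h => hyA ⟨_, ?_, h⟩⟩
      simp
  · refine le_trans (Set.ncard_le_ncard (t := r '' {v | Odd (sdeg H v)}) ?_ (Set.toFinite _))
      (le_trans (Set.ncard_image_le (Set.toFinite _)) hodd)
    intro e he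
    rw [Set.mem_ofPred_eq] at he
    obtain ⟨u, v, huv⟩ : ∃ u v, e.1 = s(u, v) := by
      induction h : e.1 with | _ u v => exact ⟨u, v, rfl⟩
    rw [gdeg_split K (fun v e f h => (hK1 v e f h).1) F hF e u v huv] at he
    have hu : u ∈ e.1 := by rw [huv]; simp
    have hv : v ∈ e.1 := by rw [huv]; simp
    have aux : ∀ u v, v ∈ e.1 → e ∈ T u → e ∉ T v → e ∈ r '' {v | Odd (sdeg H v)} := by
      intro u v hv h1 h2
      obtain ⟨h3, h4⟩ := hT3 v e (hT1 u e h1).1 hv h2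
      exact ⟨v, h4, h3.symm⟩
    rw [Nat.odd_add, hK3, ← Nat.not_odd_iff_even, hK3] at he
    by_cases h1 : e ∈ T u
    · exact aux u v hv h1 (he.1 h1)
    · exact aux v u hu (by tauto) h1
  · intro e f h
    rw [lineGraph_adj_iff_exists] at h
    obtain ⟨hne, v, hve, hvf⟩ := h
    by_cases hv : v ∈ H.verts
    · exact Or.inl ⟨v, hv, hve⟩
    have hlt : gdeg G v < 3 := by
      by_contra hh; exact hv (hall v (by omega))
    have hsub : ({e, f} : Set G.edgeSet) ⊆ {e : G.edgeSet | v ∈ e.1} := by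
      rintro x (rfl | rfl)
      · exact hve
      · exact hvf
    have hge : 2 ≤ gdeg G v := by
      rw [gdeg_eq_edges', ← Set.ncard_pair hne]
      exact Set.ncard_le_ncard hsub (Set.toFinite _)
    have heq : ({e, f} : Set G.edgeSet) = {e : G.edgeSet | v ∈ e.1} := by
      refine Set.eq_of_subset_of_ncard_le hsub ?_ (Set.toFinite _)
      rw [← gdeg_eq_edges', Set.ncard_pair hne]; omega
    obtain ⟨u, hvu, hu⟩ := N2 v hv (by omega)
    have hm : (⟨s(v, u), hvu⟩ : G.edgeSet) ∈ ({e, f} : Set G.edgeSet) := by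
      rw [heq]; simp
    rcases hm with h | h
    · exact Or.inl ⟨u, hall u hu, by rw [← h]; simp⟩
    · exact Or.inr ⟨u, hall u hu, by rw [← h]; simp⟩

lemma extend_end {V : Type*} [Finite V] {G : SimpleGraph V} (hG : G.Connected) {H : G.Subgraph}
    (hH : MaxEUP G H) (hz : ∃ z, 3 ≤ gdeg G z) {x y : V} (p : G.Walk x y) (hp : p.IsPath)
    (hl : 0 < p.length) (hd : ∀ e ∈ p.edges, e ∉ H.edgeSet) (hy : gdeg G y = 2) :
    ∃ t, ∃ h : G.Adj y t, t ∉ p.support ∧ s(y, t) ∉ H.edgeSet := by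
  classical
  have hnil : ¬ p.Nil := by
    rw [← Walk.length_eq_zero_iff]; omega
  have hpe : s(p.penultimate, y) ∈ p.edges := by
    have := getVert_edge p (i := p.length - 1) (by omega)
    rw [show p.length - 1 + 1 = p.length by omega, Walk.getVert_length] at this
    exact this
  have hyH : y ∉ H.verts := by
    intro h
    have := hH.full hG h hy (p.adj_penultimate hnil).symm
    exact hd _ hpe this.symm
  obtain ⟨e, f, hef, he, hf⟩ := two_edges (G := G) (v := y) (by omega)
  have : ∃ t, G.Adj y t ∧ t ≠ p.penultimate := by
    obtain ⟨a, ha⟩ := Sym2.mem_iff_exists.1 he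
    obtain ⟨b, hb⟩ := Sym2.mem_iff_exists.1 hf
    have ha' : G.Adj y a := by have := e.2; rw [ha] at this; exact this
    have hb' : G.Adj y b := by have := f.2; rw [hb] at this; exact this
    by_cases h : a = p.penultimate
    · refine ⟨b, hb', fun h' => hef (Subtype.ext ?_)⟩
      rw [ha, hb, h, h']
    · exact ⟨a, ha', h⟩
  obtain ⟨t, ht, htp⟩ := this
  have hne : s(y, t) ∉ H.edgeSet := fun h => hyH (H.mem_verts_of_mem_edge h (by simp))
  refine ⟨t, ht, fun hts => ?_, hne⟩
  have hnot : s(y, t) ∉ p.edges := fun h => htp (hp.eq_penultimate_of_mem_edges h)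
  refine hH.no_cycle hG hz ((p.dropUntil t hts).concat ht) ?_ (by simp) ?_
  · rw [Walk.isTrail_def, Walk.edges_concat, List.concat_eq_append, List.nodup_append]
    refine ⟨(hp.dropUntil hts).isTrail.edges_nodup, by simp, ?_⟩
    intro a ha b hb hab
    rw [List.mem_singleton] at hb
    subst hb; subst hab
    exact hnot (p.edges_dropUntil_subset_edges hts ha)
  · intro e he
    rw [Walk.edges_concat, List.concat_eq_append, List.mem_append, List.mem_singleton] at he
    rcases he with he | rfl
    · exact hd _ (p.edges_dropUntil_subset_edges hts he)
    · exact hne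

/-- auxiliary paths through `v` -/
def GoodP {V : Type*} {G : SimpleGraph V} (H : G.Subgraph) (v : V) {x y : V} (p : G.Walk x y) :
    Prop :=
  p.IsPath ∧ v ∈ p.support ∧ v ≠ x ∧ v ≠ y ∧
    (∀ w ∈ p.support, w ≠ x → w ≠ y → gdeg G w = 2) ∧ ∀ e ∈ p.edges, e ∉ H.edgeSet

lemma GoodP.reverse {V : Type*} {G : SimpleGraph V} {H : G.Subgraph} {v x y : V} {p : G.Walk x y}
    (h : GoodP H v p) : GoodP H v p.reverse := by
  obtain ⟨h1, h2, h3, h4, h5, h6⟩ := h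
  exact ⟨h1.reverse, by simpa using h2, h4, h3,
    fun w hw hy hx => h5 w (by simpa using hw) hx hy, fun e he => h6 e (by simpa using he)⟩

lemma GoodP.pos {V : Type*} {G : SimpleGraph V} {H : G.Subgraph} {v x y : V} {p : G.Walk x y}
    (h : GoodP H v p) : 0 < p.length := by
  obtain ⟨h1, h2, h3, h4, h5, h6⟩ := h
  cases p with
  | nil => simp at h2; exact absurd h2 h3
  | cons => simp

lemma GoodP.end_ne {V : Type*} [Finite V] {G : SimpleGraph V} (hG : G.Connected) {H : G.Subgraph}
    (hH : MaxEUP G H) (hz : ∃ z, 3 ≤ gdeg G z) {v x y : V} {p : G.Walk x y}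
    (hp : GoodP H v p)
    (hmax : ∀ (x' y' : V) (q : G.Walk x' y'), GoodP H v q → q.length ≤ p.length) :
    gdeg G y ≠ 2 := by
  intro hy
  obtain ⟨t, ht, hts, hte⟩ := extend_end hG hH hz p hp.1 hp.pos hp.2.2.2.2.2 hy
  obtain ⟨h1, h2, h3, h4, h5, h6⟩ := hp
  have := hmax x t (p.concat ht) ⟨h1.concat hts ht, by simp [Walk.support_concat, h2], h3,
    fun h => hts (h ▸ h2), ?_, ?_⟩
  · simp at this
  · intro w hw hwx hwt
    rw [Walk.support_concat, List.mem_append, List.mem_singleton] at hw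
    rcases hw with hw | hw
    · by_cases hwy : w = y
      · rw [hwy]; exact hy
      · exact h5 w hw hwx hwy
    · exact absurd hw hwt
  · intro e he
    rw [Walk.edges_concat, List.concat_eq_append, List.mem_append, List.mem_singleton] at he
    rcases he with he | rfl
    · exact h6 e he
    · exact hte

lemma N2_aux {V : Type*} [Finite V] {G : SimpleGraph V} (hG : G.Connected) {H : G.Subgraph}
    (hH : MaxEUP G H) (hz : ∃ z, 3 ≤ gdeg G z) {v : V} (hv : v ∉ H.verts) (h2 : gdeg G v = 2) :
    ∃ u, G.Adj v u ∧ 3 ≤ gdeg G u := by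
  classical
  by_contra hcon
  push Not at hcon
  have := Fintype.ofFinite V
  have hex : ∃ n, ∃ (x y : V) (p : G.Walk x y), GoodP H v p ∧ p.length = n := by
    obtain ⟨e, f, hef, he, hf⟩ := two_edges (G := G) (v := v) (by omega)
    obtain ⟨a, ha⟩ := Sym2.mem_iff_exists.1 he
    obtain ⟨b, hb⟩ := Sym2.mem_iff_exists.1 hf
    have ha' : G.Adj v a := by have := e.2; rw [ha] at this; exact this
    have hb' : G.Adj v b := by have := f.2; rw [hb] at this; exact this
    have hab : a ≠ b := fun h => hef (Subtype.ext (by rw [ha, hb, h]))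
    refine ⟨2, a, b, Walk.cons ha'.symm (Walk.cons hb' Walk.nil), ⟨?_, by simp, ha'.ne, hb'.ne,
      ?_, ?_⟩, by simp⟩
    · simp [Walk.isPath_def, ha'.ne', hb'.ne, hab]
    · intro w hw hwa hwb
      simp at hw
      rcases hw with rfl | rfl | rfl
      · exact absurd rfl hwa
      · exact h2
      · exact absurd rfl hwb
    · intro e he heH
      refine hv (H.mem_verts_of_mem_edge heH ?_)
      simp at he
      rcases he with rfl | rfl <;> simp
  obtain ⟨n0, hn0⟩ := hex
  have hbd : ∀ n, (∃ (x y : V) (p : G.Walk x y), GoodP H v p ∧ p.length = n) →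
      n ≤ Fintype.card V := by
    rintro n ⟨x, y, p, hp, rfl⟩
    exact hp.1.length_lt.le
  obtain ⟨x, y, p, hp, hpl⟩ := Nat.findGreatest_spec (P := fun n => ∃ (x y : V) (p : G.Walk x y),
    GoodP H v p ∧ p.length = n) (hbd n0 hn0) hn0
  have hmax : ∀ (x' y' : V) (q : G.Walk x' y'), GoodP H v q → q.length ≤ p.length := by
    intro x' y' q hq
    rw [hpl]
    exact Nat.le_findGreatest (hbd _ ⟨x', y', q, hq, rfl⟩) ⟨x', y', q, hq, rfl⟩
  have hy := hp.end_ne hG hH hz hmax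
  have hx := hp.reverse.end_ne hG hH hz (by simpa using hmax)
  have hpos := hp.pos
  have hbr : IsBranch G p := ⟨hp.1, hp.pos, hx, hy, hp.2.2.2.2.1⟩
  obtain ⟨-, -, -, -, hIV, hV⟩ := hH.1
  have h3 := hIV x y p hbr hp.2.2.2.2.2
  obtain ⟨i, hi, hil⟩ := Walk.mem_support_iff_exists_getVert.1 hp.2.1
  have hi0 : i ≠ 0 := by
    rintro rfl; rw [Walk.getVert_zero] at hi; exact hp.2.2.1 hi.symm
  have hiN : i ≠ p.length := by
    rintro rfl; rw [Walk.getVert_length] at hi; exact hp.2.2.2.1 hi.symm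
  have hadj1 : i = 1 → G.Adj v x := by
    rintro rfl
    have := p.adj_getVert_succ (i := 0) (by omega)
    rw [Walk.getVert_zero, zero_add, hi] at this
    exact this.symm
  have hadj2 : i + 1 = p.length → G.Adj v y := by
    intro h
    have := p.adj_getVert_succ (i := i) (by omega)
    rw [h, Walk.getVert_length, hi] at this
    exact this
  have hone : ∀ w, G.Adj v w → gdeg G w ≠ 2 → gdeg G w = 1 := by
    intro w hw hw2
    have h1 := hcon w hw
    have h0 := gdeg_pos hw.symm
    omega
  have hlen : p.length ≤ 2 := by
    refine hV x y p hbr ?_ hp.2.2.2.2.2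
    rcases (by omega : i = 1 ∨ i + 1 = p.length) with h | h
    · exact ⟨x, p.start_mem_support, hone x (hadj1 h) hx⟩
    · exact ⟨y, p.end_mem_support, hone y (hadj2 h) hy⟩
  have hvx := hadj1 (by omega)
  have hvy := hadj2 (by omega)
  have hx1 := hone x hvx hx
  have hy1 := hone y hvy hy
  have hxy : x ≠ y := by
    rintro rfl
    have h := Walk.length_eq_zero_iff.2 (Walk.isPath_iff_nil.1 hp.1)
    omega
  obtain ⟨z, hz⟩ := hz
  obtain ⟨a, ha, b, hb, hab⟩ := conn_cut hG {x, v, y} v z (by simp) (by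
    rintro (rfl | rfl | rfl) <;> omega)
  simp only [Set.mem_insert_iff, Set.mem_singleton_iff, not_or] at ha hb
  obtain ⟨hb1, hb2, hb3⟩ := hb
  rcases ha with rfl | rfl | rfl
  · have := card_le_gdeg (G := G) (v := a) {v, b} (by simp [hab, hvx.symm])
    rw [Finset.card_pair (Ne.symm hb2)] at this; omega
  · have := card_le_gdeg (G := G) (v := a) {x, y, b} (by simp [hab, hvx, hvy])
    rw [Finset.card_eq_three.2 ⟨x, y, b, hxy, Ne.symm hb1, Ne.symm hb3, rfl⟩] at this; omega
  · have := card_le_gdeg (G := G) (v := a) {v, b} (by simp [hab, hvy.symm])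
    rw [Finset.card_pair (Ne.symm hb2)] at this; omega

/-- `L²(G)` is traceable iff `EUP₂(G) ≠ ∅`. -/
theorem stmt9 {V : Type} (G : SimpleGraph V) (hG : G.Connected)
    (h3 : 3 ≤ G.edgeSet.ncard) :
    Traceable (iterLine ⟨V, G⟩ 2).2 ↔ (EUP G 2).Nonempty := by
  classical
  change Traceable G.lineGraph.lineGraph ↔ (EUP G 2).Nonempty
  have hfin : G.edgeSet.Finite := Set.finite_of_ncard_pos (by omega)
  have hnt : Nontrivial V := by
    obtain ⟨e, he⟩ := Set.nonempty_of_ncard_ne_zero (s := G.edgeSet) (by omega)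
    induction e with | _ u v => exact ⟨u, v, (show G.Adj u v from he).ne⟩
  have hnb : ∀ v, ∃ w, G.Adj v w := by
    intro v
    obtain ⟨w, hw⟩ := exists_ne v
    obtain ⟨x, hx, y, -, hxy⟩ := conn_cut hG {v} v w rfl hw
    rw [Set.mem_singleton_iff] at hx
    subst hx
    exact ⟨y, hxy⟩
  have hV : Finite V := by
    have h1 : (⋃ e ∈ G.edgeSet, (e : Set V)).Finite := by
      refine hfin.biUnion fun e _ => ?_
      induction e with | _ u v =>
        rw [Sym2.coe_mk]; exact Set.toFinite _
    refine Set.finite_univ_iff.1 (h1.subset fun v _ => ?_)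
    obtain ⟨w, hw⟩ := hnb v
    exact Set.mem_biUnion (x := s(v, w)) hw (by simp)
  have hX : G.lineGraph.edgeSet.Nonempty := by
    obtain ⟨e, he⟩ := Set.nonempty_of_ncard_ne_zero (s := G.edgeSet) (by omega)
    induction e with | _ u v =>
    have huv : G.Adj u v := he
    by_cases hall : ∀ z, z = u ∨ z = v
    · exfalso
      have hsub : G.edgeSet ⊆ {s(u, v)} := by
        intro f hf
        induction f with | _ a b =>
        have hab : G.Adj a b := hf
        have := hab.ne
        rw [Set.mem_singleton_iff]
        rcases hall a with rfl | rfl <;> rcases hall b with rfl | rfl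
        · exact absurd rfl this
        · rfl
        · exact Sym2.eq_swap
        · exact absurd rfl this
      have := Set.ncard_le_ncard hsub (Set.toFinite _)
      rw [Set.ncard_singleton] at this
      omega
    · push Not at hall
      obtain ⟨z, hzu, hzv⟩ := hall
      obtain ⟨a, ha, b, hb, hab⟩ := conn_cut hG {u, v} u z (by simp) (by simp [hzu, hzv])
      simp only [Set.mem_insert_iff, Set.mem_singleton_iff, not_or] at ha hb
      have hadj : G.lineGraph.Adj ⟨s(u, v), huv⟩ ⟨s(a, b), hab⟩ := by
        rw [lineGraph_adj_iff_exists]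
        refine ⟨fun h => ?_, a, by simpa using ha, by simp⟩
        have h' : s(u, v) = s(a, b) := congrArg Subtype.val h
        have : b ∈ s(u, v) := by rw [h']; simp
        rw [Sym2.mem_iff] at this
        tauto
      exact ⟨s(_, _), hadj⟩
  constructor
  · intro h
    obtain ⟨F, S, hD⟩ := DomSub.of_traceable h
    by_cases hz : ∃ z, 3 ≤ gdeg G z
    · exact EUP_of_dom hG hD hz
    · push Not at hz
      exact ⟨⊤, top_EUP hG (fun v => by have := hz v; omega)⟩
  · intro h
    have : ∃ F S, DomSub G.lineGraph F S := by
      by_cases hz : ∃ z, 3 ≤ gdeg G z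
      · obtain ⟨H, hH⟩ := exists_max h
        refine core hG hH.1 ?_ (fun v hv h2 w hw => hH.full hG hv h2 hw)
          (fun v hv h2 => N2_aux hG hH hz hv h2) hnb
        obtain ⟨z, hz⟩ := hz
        exact ⟨z, hH.1.2.2.1 z hz⟩
      · push Not at hz
        have hne : Nonempty V := hG.nonempty
        exact core hG (top_EUP hG (fun v => by have := hz v; omega)) (by simp)
          (fun v _ _ w hw => by simpa using hw) (fun v hv => absurd (by simp) hv) hnb
    obtain ⟨F, S, hD⟩ := this
    exact hD.traceable hX
end Paper
end

section
/- Let G be a connected graph of order n, let mt*(G) be the maximum number of vertices on a trail of G, and among such maximum trails let d*_{≥3}(G) be the minimum possible number of vertices of degree at least 3 lying outside the trail. Then the hamiltonian path index satisfies h_p(G) ≤ n − mt*(G) − d*_{≥3}(G) + 2. -/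
open SimpleGraph

namespace Paper

/-- The line-graph edge `d` is centered at a vertex of `C`. -/
def Cent {V : Type} {G : SimpleGraph V} (C : Set V) (d : Sym2 G.edgeSet) : Prop :=
  ∃ c ∈ C, ∀ z ∈ d, c ∈ (z : Sym2 V)

theorem lg_adj {V : Type} {G : SimpleGraph V} {e f : G.edgeSet} (h : e ≠ f) {c : V}
    (h1 : c ∈ (e : Sym2 V)) (h2 : c ∈ (f : Sym2 V)) : G.lineGraph.Adj e f :=
  ⟨h, ⟨c, h1, h2⟩⟩

theorem cent_unique {V : Type} {G : SimpleGraph V} {C : Set V} {y : V} (hy : y ∉ C)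
    {d : Sym2 G.edgeSet} (hd : d ∈ G.lineGraph.edgeSet) (h1 : Cent C d) (h2 : Cent {y} d) :
    False := by
  induction d using Sym2.ind with
  | _ e f =>
    obtain ⟨c, hc, h⟩ := h1
    obtain ⟨y', rfl, h'⟩ := h2
    have hne : e ≠ f := hd.1
    have hcy : c ≠ y' := fun h => hy (h ▸ hc)
    apply hne
    apply Subtype.ext
    exact Sym2.eq_of_ne_mem hcy (h e (by simp)) (h' e (by simp)) (h f (by simp)) (h' f (by simp))

theorem walk_of_list {V : Type} {G : SimpleGraph V} {C : Set V} (l : List G.edgeSet)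
    (hne : l ≠ []) (hnd : l.Nodup)
    (hc : l.IsChain (fun e f : G.edgeSet => ∃ c ∈ C, c ∈ (e : Sym2 V) ∧ c ∈ (f : Sym2 V))) :
    ∃ p : G.lineGraph.Walk (l.head hne) (l.getLast hne), p.support = l ∧
      ∀ d ∈ p.edges, Cent C d := by
  induction l with
  | nil => exact absurd rfl hne
  | cons a l ih =>
    cases l with
    | nil => exact ⟨Walk.nil, by simp, by simp⟩
    | cons b l =>
      rw [List.isChain_cons_cons] at hc
      obtain ⟨p, hp, hpc⟩ := ih (by simp) hnd.of_cons hc.2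
      obtain ⟨c, hcC, h1, h2⟩ := hc.1
      have hab : a ≠ b := by
        rintro rfl
        simp at hnd
      have hadj : G.lineGraph.Adj a b := lg_adj hab h1 h2
      have key : ∃ z, z = (b :: l).getLast (by simp) ∧ ∃ q : G.lineGraph.Walk b z,
          q.support = b :: l ∧ ∀ d ∈ q.edges, Cent C d := ⟨_, rfl, p, hp, hpc⟩
      clear hp hpc p
      obtain ⟨z, hz, p, hp, hpc⟩ := key
      suffices hs : ∃ q : G.lineGraph.Walk a z, q.support = a :: b :: l ∧
          ∀ d ∈ q.edges, Cent C d by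
        subst hz
        exact hs
      refine ⟨Walk.cons hadj p, by simp [hp], ?_⟩
      intro d hd
      rw [Walk.edges_cons, List.mem_cons] at hd
      rcases hd with rfl | hd
      · refine ⟨c, hcC, ?_⟩
        intro z hz
        simp at hz
        rcases hz with rfl | rfl
        · exact h1
        · exact h2
      · exact hpc d hd

theorem chain_of_common {V : Type} {G : SimpleGraph V} {C : Set V} (l : List G.edgeSet)
    (c : V) (hc : c ∈ C) (h : ∀ e ∈ l, c ∈ (e : Sym2 V)) :
    l.IsChain (fun e f : G.edgeSet => ∃ c ∈ C, c ∈ (e : Sym2 V) ∧ c ∈ (f : Sym2 V)) := by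
  induction l with
  | nil => simp
  | cons a l ih =>
    cases l with
    | nil => simp
    | cons b l =>
      rw [List.isChain_cons_cons]
      exact ⟨⟨c, hc, h a (by simp), h b (by simp)⟩, ih (fun e he => h e (List.mem_cons_of_mem _ he))⟩

theorem exists_list {α : Type} [Finite α] (P : α → Prop) :
    ∃ l : List α, l.Nodup ∧ ∀ x, x ∈ l ↔ P x := by
  classical
  have := Fintype.ofFinite α
  exact ⟨(Finset.univ.filter P).toList, Finset.nodup_toList _, by simp⟩

theorem trail_list {V : Type} [Finite V] {G : SimpleGraph V} {C : Set V} {u v : V}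
    (t : G.Walk u v) : t.IsTrail → (∀ x ∈ t.support, x ∈ C) →
    ∀ F : Set (Sym2 V), (∀ e ∈ t.edges, e ∉ F) →
    ∃ l : List G.edgeSet, l.Nodup ∧
      l.IsChain (fun e f : G.edgeSet => ∃ c ∈ C, c ∈ (e : Sym2 V) ∧ c ∈ (f : Sym2 V)) ∧
      (∀ e ∈ l.head?, u ∈ (e : Sym2 V)) ∧
      (∀ e : G.edgeSet, e ∈ l ↔ (e : Sym2 V) ∉ F ∧ ∃ x ∈ t.support, x ∈ (e : Sym2 V)) := by
  induction t with
  | @nil u =>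
    intro _ hC F _
    obtain ⟨l, hl, hm⟩ := exists_list (fun e : G.edgeSet => (e : Sym2 V) ∉ F ∧ u ∈ (e : Sym2 V))
    refine ⟨l, hl, chain_of_common l u (hC u (by simp)) (fun e he => ((hm e).1 he).2), ?_, ?_⟩
    · intro e he
      exact ((hm e).1 (List.mem_of_mem_head? he)).2
    · intro e
      rw [hm]
      simp
  | @cons u w v h t ih =>
    intro ht hC F hF
    rw [Walk.isTrail_cons] at ht
    obtain ⟨A, hA, hAm⟩ := exists_list (fun e : G.edgeSet => (e : Sym2 V) ∉ F ∧
      (e : Sym2 V) ∉ (Walk.cons h t).edges ∧ u ∈ (e : Sym2 V))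
    let e1 : G.edgeSet := ⟨s(u, w), h⟩
    obtain ⟨l, hl, hch, hhd, hm⟩ := ih ht.1 (fun x hx => hC x (by simp [hx]))
      (F ∪ {e | e = s(u, w) ∨ (e ∉ t.edges ∧ u ∈ e)}) (by
        intro e he hh
        rcases hh with hh | hh | hh
        · exact hF e (by simp [he]) hh
        · exact ht.2 (hh ▸ he)
        · exact hh.1 he)
    have huC : u ∈ C := hC u (by simp)
    have hwC : w ∈ C := hC w (by simp)
    have hch2 : (e1 :: l).IsChain (fun e f : G.edgeSet => ∃ c ∈ C, c ∈ (e : Sym2 V) ∧ c ∈ (f : Sym2 V)) := by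
      rw [List.isChain_cons]
      refine ⟨fun y hy => ⟨w, hwC, by simp [e1], hhd y hy⟩, hch⟩
    have he1l : e1 ∉ l := by
      rw [hm]
      simp [e1]
    refine ⟨A ++ (e1 :: l), ?_, ?_, ?_, ?_⟩
    · rw [List.nodup_append]
      refine ⟨hA, by simp [he1l, hl], ?_⟩
      intro a ha b hb hab
      subst hab
      rw [hAm] at ha
      rw [List.mem_cons] at hb
      rcases hb with hb | hb
      · apply ha.2.1
        rw [hb]
        simp [e1]
      · rw [hm] at hb
        apply hb.1
        right; right
        exact ⟨fun h => ha.2.1 (by simp [h]), ha.2.2⟩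
    · rw [List.isChain_append]
      refine ⟨chain_of_common A u huC (fun e he => ((hAm e).1 he).2.2), hch2, ?_⟩
      intro x hx y hy
      simp at hy
      subst hy
      exact ⟨u, huC, ((hAm x).1 (List.mem_of_mem_getLast? hx)).2.2, by simp [e1]⟩
    · intro e he
      cases A with
      | nil =>
        simp at he
        subst he
        simp [e1]
      | cons a A =>
        simp at he
        subst he
        exact ((hAm _).1 (by simp)).2.2
    · intro e
      have hee : e = e1 ↔ (e : Sym2 V) = s(u, w) := by
        rw [Subtype.ext_iff]
      have hsup : ∀ z ∈ t.edges, ∃ x ∈ t.support, x ∈ z := by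
        intro z hz
        induction z using Sym2.ind with
        | _ a b => exact ⟨a, Walk.fst_mem_support_of_mem_edges t hz, by simp⟩
      rw [List.mem_append, List.mem_cons, hAm, hm, hee]
      simp only [Walk.edges_cons, List.mem_cons, Walk.support_cons, Set.mem_union,
        Set.mem_ofPred_eq]
      have hF1 : s(u, w) ∉ F := hF _ (by simp)
      have hF2 : ∀ z ∈ t.edges, z ∉ F := fun z hz => hF z (by simp [hz])
      have hw : w ∈ t.support := by simp
      have hu1 : u ∈ s(u, w) := by simp
      constructor
      · rintro (⟨h1, h2, h3⟩ | h1 | ⟨h1, x, h2, h3⟩)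
        · exact ⟨h1, u, Or.inl rfl, h3⟩
        · rw [h1]
          exact ⟨hF1, u, Or.inl rfl, hu1⟩
        · exact ⟨fun h => h1 (Or.inl h), x, Or.inr h2, h3⟩
      · rintro ⟨h1, x, h2, h3⟩
        by_cases hq : (e : Sym2 V) = s(u, w)
        · exact Or.inr (Or.inl hq)
        by_cases hq2 : (e : Sym2 V) ∈ t.edges
        · right; right
          refine ⟨?_, hsup _ hq2⟩
          tauto
        · by_cases hq3 : u ∈ (e : Sym2 V)
          · left; tauto
          · right; right
            refine ⟨by tauto, x, ?_, h3⟩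
            rcases h2 with rfl | h2
            · exact absurd h3 hq3
            · exact h2

/-- `C` is good: some trail of the line graph covers all edges meeting `C`, using only
line-graph edges centered in `C`. -/
def Good {V : Type} (G : SimpleGraph V) (C : Set V) : Prop :=
  ∃ (e f : G.edgeSet) (p : G.lineGraph.Walk e f), p.IsTrail ∧
    (∀ g : G.edgeSet, (∃ x ∈ C, x ∈ (g : Sym2 V)) → g ∈ p.support) ∧
    ∀ d ∈ p.edges, Cent C d

theorem good_path {V : Type} [Finite V] {G : SimpleGraph V} {u v : V}
    (t : G.Walk u v) (ht : t.IsTrail)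
    (hne : ∃ g : G.edgeSet, ∃ x ∈ t.support, x ∈ (g : Sym2 V)) :
    ∃ (e f : G.edgeSet) (p : G.lineGraph.Walk e f), p.IsPath ∧
    (∀ g : G.edgeSet, (∃ x ∈ t.support, x ∈ (g : Sym2 V)) → g ∈ p.support) ∧
    ∀ d ∈ p.edges, Cent {x | x ∈ t.support} d := by
  obtain ⟨l, hl, hch, -, hm⟩ := trail_list (C := {x | x ∈ t.support}) t ht (fun x hx => hx) ∅
    (by simp)
  have hn : l ≠ [] := by
    obtain ⟨g, hg⟩ := hne
    exact List.ne_nil_of_mem ((hm g).2 ⟨by simp, hg⟩)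
  obtain ⟨p, hp, hpc⟩ := walk_of_list l hn hl hch
  refine ⟨_, _, p, ?_, ?_, hpc⟩
  · rw [Walk.isPath_def, hp]; exact hl
  · intro g hg
    rw [hp, hm]
    exact ⟨by simp, hg⟩

theorem good_insert {V : Type} [Finite V] {G : SimpleGraph V} {C : Set V} (hC : Good G C)
    {c y : V} (hc : c ∈ C) (hy : y ∉ C) (hcy : G.Adj c y) (hd : 3 ≤ gdeg G y) :
    Good G (insert y C) := by
  classical
  obtain ⟨e, f, p, hp, hcov, hcent⟩ := hC
  let e0 : G.edgeSet := ⟨s(c, y), hcy⟩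
  have he0 : e0 ∈ p.support := hcov e0 ⟨c, hc, by simp [e0]⟩
  obtain ⟨l, hl, hm⟩ := exists_list (fun g : G.edgeSet => y ∈ (g : Sym2 V) ∧ g ≠ e0)
  -- the list has at least two elements
  have hlen : 2 ≤ l.length := by
    have hsub : G.neighborSet y ⊆ insert c ((fun g : G.edgeSet =>
        if h : y ∈ (g : Sym2 V) then Sym2.Mem.other h else y) '' {g | g ∈ l}) := by
      intro z hz
      by_cases hzc : z = c
      · exact Or.inl hzc
      right
      refine ⟨⟨s(y, z), hz⟩, ?_, ?_⟩
      · show _ ∈ l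
        rw [hm]
        refine ⟨by simp, ?_⟩
        intro h
        have h2 : s(y, z) = s(c, y) := congrArg Subtype.val h
        rw [Sym2.eq_iff] at h2
        rcases h2 with h2 | h2
        · exact hcy.ne h2.1.symm
        · exact hzc h2.2
      · have hmem : y ∈ s(y, z) := by simp
        simp only [hmem, dite_true]
        exact Sym2.congr_right.1 (Sym2.other_spec hmem)
    have h1 := Set.ncard_le_ncard hsub (Set.toFinite _)
    have h2 := Set.ncard_insert_le c ((fun g : G.edgeSet =>
        if h : y ∈ (g : Sym2 V) then Sym2.Mem.other h else y) '' {g | g ∈ l})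
    have h3 := Set.ncard_image_le (f := (fun g : G.edgeSet =>
        if h : y ∈ (g : Sym2 V) then Sym2.Mem.other h else y)) (Set.toFinite {g | g ∈ l})
    have h4 : {g | g ∈ l}.ncard ≤ l.length := by
      have : {g | g ∈ l} = (l.toFinset : Set G.edgeSet) := by ext; simp
      rw [this, Set.ncard_coe_finset]
      exact List.toFinset_card_le l
    unfold gdeg at hd
    omega
  obtain ⟨a, b, l, rfl⟩ : ∃ a b l', l = a :: b :: l' := by
    match l, hlen with
    | a :: b :: l', _ => exact ⟨a, b, l', rfl⟩
  obtain ⟨z, hz, q, hq, hqc⟩ : ∃ z, z = (a :: b :: l).getLast (by simp) ∧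
      ∃ q : G.lineGraph.Walk a z, q.support = a :: b :: l ∧ ∀ d ∈ q.edges, Cent {y} d :=
    ⟨_, rfl, walk_of_list (C := {y}) (a :: b :: l) (by simp) hl
      (chain_of_common _ y rfl (fun e he => ((hm e).1 he).1))⟩
  have hzl : z ∈ b :: l := by
    rw [hz, List.getLast_cons (by simp)]
    exact List.getLast_mem _
  have hza : z ≠ a := by
    rintro h
    rw [h] at hzl
    exact (List.nodup_cons.1 hl).1 hzl
  have ha := (hm a).1 (by simp)
  have hzm := (hm z).1 (List.mem_cons_of_mem _ hzl)
  have hye0 : y ∈ (e0 : Sym2 V) := by simp [e0]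
  have hadj1 : G.lineGraph.Adj e0 a := lg_adj ha.2.symm hye0 ha.1
  have hadj2 : G.lineGraph.Adj z e0 := lg_adj hzm.2 hzm.1 hye0
  have he0l : e0 ∉ a :: b :: l := fun h => ((hm e0).1 h).2 rfl
  let r : G.lineGraph.Walk e0 e0 := Walk.cons hadj1 (q.append (Walk.cons hadj2 Walk.nil))
  have hqt : q.IsTrail := by
    apply Walk.IsPath.isTrail
    rw [Walk.isPath_def, hq]; exact hl
  have hqe : ∀ w, s(e0, w) ∉ q.edges := by
    intro w hw
    exact he0l (hq ▸ Walk.fst_mem_support_of_mem_edges q hw)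
  have hrt : r.IsTrail := by
    simp only [r]
    rw [Walk.isTrail_cons, Walk.isTrail_append]
    refine ⟨⟨hqt, by simp, ?_⟩, ?_⟩
    · intro d hd hd2
      simp at hd2
      rw [hd2, Sym2.eq_swap] at hd
      exact hqe _ hd
    · rw [Walk.edges_append]
      simp only [List.mem_append, Walk.edges_cons, Walk.edges_nil, List.mem_singleton]
      rintro (h | h)
      · exact hqe _ h
      · rw [Sym2.eq_iff] at h
        rcases h with h | h
        · exact hzm.2 h.1.symm
        · exact hza h.2.symm
  have hrc : ∀ d ∈ r.edges, Cent {y} d := by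
    intro d hd
    simp only [r, Walk.edges_cons, Walk.edges_append, List.mem_cons, List.mem_append,
      Walk.edges_nil, List.not_mem_nil, or_false] at hd
    rcases hd with rfl | hd | rfl
    · refine ⟨y, rfl, ?_⟩
      intro w hw
      simp at hw
      rcases hw with rfl | rfl
      · exact hye0
      · exact ha.1
    · exact hqc d hd
    · refine ⟨y, rfl, ?_⟩
      intro w hw
      rw [Sym2.mem_iff] at hw
      rcases hw with rfl | rfl
      · exact hzm.1
      · exact hye0
  have hdisj : ∀ d ∈ r.edges, d ∉ p.edges := fun d hd hd2 =>
    cent_unique hy (Walk.edges_subset_edgeSet p hd2) (hcent d hd2) (hrc d hd)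
  have hspec := p.take_spec he0
  have hpe : p.edges = (p.takeUntil e0 he0).edges ++ (p.dropUntil e0 he0).edges := by
    rw [← Walk.edges_append, hspec]
  have hps : ∀ g, g ∈ p.support ↔ g ∈ (p.takeUntil e0 he0).support ∨
      g ∈ (p.dropUntil e0 he0).support := by
    intro g
    rw [← Walk.mem_support_append_iff, hspec]
  have hp' := hp
  rw [← hspec, Walk.isTrail_append] at hp'
  refine ⟨e, f, (p.takeUntil e0 he0).append (r.append (p.dropUntil e0 he0)), ?_, ?_, ?_⟩
  · rw [Walk.isTrail_append, Walk.isTrail_append, Walk.edges_append]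
    refine ⟨hp'.1, ⟨hrt, hp'.2.1, ?_⟩, ?_⟩
    · intro d h1 h2
      exact hdisj d h1 (by rw [hpe]; simp [h2])
    · intro d h1 h2
      rw [List.mem_append] at h2
      rcases h2 with h2 | h2
      · exact hdisj d h2 (by rw [hpe]; simp [h1])
      · exact hp'.2.2 h1 h2
  · rintro g ⟨x, hx, hxg⟩
    rw [Walk.mem_support_append_iff, Walk.mem_support_append_iff]
    rcases hx with rfl | hx
    · right; left
      by_cases hg : g = e0
      · rw [hg]; simp
      · have : g ∈ q.support := by
          rw [hq, hm]; exact ⟨hxg, hg⟩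
        simp only [r, Walk.support_cons, List.mem_cons, Walk.mem_support_append_iff]
        exact Or.inr (Or.inl this)
    · have := (hps g).1 (hcov g ⟨x, hx, hxg⟩)
      tauto
  · intro d hd
    rw [Walk.edges_append, Walk.edges_append, List.mem_append, List.mem_append] at hd
    by_cases h : d ∈ r.edges
    · obtain ⟨y', rfl, h'⟩ := hrc d h
      exact ⟨_, Set.mem_insert _ _, h'⟩
    · have : d ∈ p.edges := by
        rw [hpe, List.mem_append]; tauto
      obtain ⟨x, hx, h'⟩ := hcent d this
      exact ⟨x, Set.mem_insert_of_mem _ hx, h'⟩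

theorem inc_ncard {V : Type} [Finite V] (G : SimpleGraph V) (x : V) :
    {e : G.edgeSet | x ∈ (e : Sym2 V)}.ncard = gdeg G x := by
  classical
  have h1 : (Subtype.val '' {e : G.edgeSet | x ∈ (e : Sym2 V)}) = G.incidenceSet x := by
    ext e
    constructor
    · rintro ⟨e, he, rfl⟩
      exact ⟨e.2, he⟩
    · rintro ⟨h1, h2⟩
      exact ⟨⟨e, h1⟩, h2, rfl⟩
  rw [← Set.ncard_image_of_injective _ Subtype.val_injective, h1]
  unfold gdeg
  rw [← Nat.card_coe_set_eq, ← Nat.card_coe_set_eq]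
  exact Nat.card_congr (G.incidenceSetEquivNeighborSet x)

theorem line_deg {V : Type} [Finite V] (G : SimpleGraph V) (u v : V) (h : G.Adj u v) :
    gdeg G u + gdeg G v ≤ gdeg G.lineGraph ⟨s(u, v), h⟩ + 2 := by
  classical
  rw [← inc_ncard G u, ← inc_ncard G v, ← Set.ncard_union_add_ncard_inter]
  have h1 : ({e : G.edgeSet | u ∈ (e : Sym2 V)} ∪ {e : G.edgeSet | v ∈ (e : Sym2 V)}) ⊆
      insert ⟨s(u, v), h⟩ (G.lineGraph.neighborSet ⟨s(u, v), h⟩) := by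
    intro e he
    by_cases hq : e = ⟨s(u, v), h⟩
    · exact Or.inl hq
    · right
      rcases he with he | he
      · exact lg_adj (Ne.symm hq) (c := u) (by simp) he
      · exact lg_adj (Ne.symm hq) (c := v) (by simp) he
  have h2 : ({e : G.edgeSet | u ∈ (e : Sym2 V)} ∩ {e : G.edgeSet | v ∈ (e : Sym2 V)}) ⊆
      {⟨s(u, v), h⟩} := by
    rintro e ⟨h1, h2⟩
    apply Subtype.ext
    exact Sym2.eq_of_ne_mem h.ne h1 h2 (by simp) (by simp)
  have h3 := Set.ncard_le_ncard h1 (Set.toFinite _)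
  have h4 := Set.ncard_le_ncard h2 (Set.toFinite _)
  have h5 := Set.ncard_insert_le (⟨s(u, v), h⟩ : G.edgeSet)
    (G.lineGraph.neighborSet ⟨s(u, v), h⟩)
  rw [Set.ncard_singleton] at h4
  unfold gdeg
  omega

theorem arith_low (d n : ℕ) (h : n ≤ d) : n * (3 - d) ≤ if d < 3 then 2 else 0 := by
  by_cases hd : d < 3
  · interval_cases d <;> interval_cases n <;> simp
  · have : 3 - d = 0 := by omega
    simp [this]

theorem count_low {V : Type} [Finite V] (G : SimpleGraph V) (hG : G.Connected) (C : Set V)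
    (hne : C.Nonempty) (hcl : ∀ c ∈ C, ∀ y, y ∉ C → G.Adj c y → gdeg G y < 3)
    (hC : ∃ x, x ∉ C) :
    {e : G.edgeSet | gdeg G.lineGraph e < 3 ∧ ∀ x ∈ (e : Sym2 V), x ∉ C}.ncard <
      {x | gdeg G x < 3 ∧ x ∉ C}.ncard := by
  classical
  have := Fintype.ofFinite V
  have := Fintype.ofFinite G.edgeSet
  set E : Finset G.edgeSet := Finset.univ.filter
    (fun e => gdeg G.lineGraph e < 3 ∧ ∀ x ∈ (e : Sym2 V), x ∉ C) with hE
  set S : Finset V := Finset.univ.filter (fun x => gdeg G x < 3 ∧ x ∉ C) with hS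
  have hE1 : {e : G.edgeSet | gdeg G.lineGraph e < 3 ∧ ∀ x ∈ (e : Sym2 V), x ∉ C} = (E : Set _) := by
    ext; simp [hE]
  have hS1 : {x | gdeg G x < 3 ∧ x ∉ C} = (S : Set V) := by ext; simp [hS]
  rw [hE1, hS1, Set.ncard_coe_finset, Set.ncard_coe_finset]
  have step1 : ∑ e ∈ E, 2 ≤ ∑ e ∈ E, ∑ x : V, if x ∈ (e : Sym2 V) then 3 - gdeg G x else 0 := by
    apply Finset.sum_le_sum
    rintro ⟨e, he⟩ heE
    induction e using Sym2.ind with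
    | _ a b =>
      have hab : G.Adj a b := he
      have h1 := line_deg G a b hab
      have h2 : gdeg G.lineGraph ⟨s(a, b), he⟩ < 3 := by
        simp only [hE, Finset.mem_filter] at heE
        exact heE.2.1
      rw [← Finset.sum_filter]
      have h3 : (Finset.univ.filter (fun x => x ∈ s(a, b))) = {a, b} := by
        ext; simp
      simp only
      rw [h3, Finset.sum_pair hab.ne]
      omega
  have step2 : ∑ e ∈ E, ∑ x : V, (if x ∈ (e : Sym2 V) then 3 - gdeg G x else 0) =
      ∑ x : V, (E.filter (fun e : G.edgeSet => x ∈ (e : Sym2 V))).card * (3 - gdeg G x) := by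
    rw [Finset.sum_comm]
    apply Finset.sum_congr rfl
    intro x _
    rw [← Finset.sum_filter, Finset.sum_const, smul_eq_mul]
  have hdeg : ∀ x, (E.filter (fun e : G.edgeSet => x ∈ (e : Sym2 V))).card ≤ gdeg G x := by
    intro x
    rw [← inc_ncard, ← Set.ncard_coe_finset]
    apply Set.ncard_le_ncard _ (Set.toFinite _)
    intro e he
    simp at he
    exact he.2
  have hmemE : ∀ x, x ∈ C → E.filter (fun e : G.edgeSet => x ∈ (e : Sym2 V)) = ∅ := by
    intro x hx
    ext e
    simp only [hE, Finset.mem_filter, Finset.notMem_empty, iff_false]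
    rintro ⟨h1, h2⟩
    exact h1.2.2 x h2 hx
  -- a boundary vertex
  obtain ⟨c, hc⟩ := hne
  obtain ⟨x0, hx0⟩ := hC
  obtain ⟨w⟩ := hG.preconnected c x0
  obtain ⟨d, -, hd1, hd2⟩ := w.exists_boundary_dart C hc hx0
  have hylow := hcl d.fst hd1 d.snd hd2 d.adj
  have step3 : ∑ x : V, (E.filter (fun e : G.edgeSet => x ∈ (e : Sym2 V))).card * (3 - gdeg G x) <
      ∑ x : V, if gdeg G x < 3 ∧ x ∉ C then 2 else 0 := by
    apply Finset.sum_lt_sum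
    · intro x _
      by_cases hx : x ∈ C
      · simp [hmemE x hx]
      · simp only [hx, not_false_eq_true, and_true]
        exact arith_low _ _ (hdeg x)
    · refine ⟨d.snd, Finset.mem_univ _, ?_⟩
      have h1 : (E.filter (fun e : G.edgeSet => d.snd ∈ (e : Sym2 V))).card < gdeg G d.snd := by
        rw [← inc_ncard, ← Set.ncard_coe_finset]
        apply Set.ncard_lt_ncard _ (Set.toFinite _)
        refine ⟨?_, ?_⟩
        · intro e he
          simp at he
          exact he.2
        · intro hsub
          have := hsub (a := ⟨s(d.fst, d.snd), d.adj⟩) (by simp)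
          simp only [hE, Finset.coe_filter, Finset.mem_filter] at this
          exact this.1.2.2 d.fst (by simp) hd1
      simp only [hylow, hd2, not_false_eq_true, and_true, if_true]
      generalize (E.filter (fun e : G.edgeSet => d.snd ∈ (e : Sym2 V))).card = n at h1
      generalize gdeg G d.snd = m at h1 hylow
      interval_cases m <;> interval_cases n <;> simp
  have step4 : (∑ x : V, if gdeg G x < 3 ∧ x ∉ C then 2 else 0) = 2 * S.card := by
    rw [← Finset.sum_filter, Finset.sum_const, smul_eq_mul, mul_comm]
  have step0 : ∑ e ∈ E, 2 = 2 * E.card := by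
    rw [Finset.sum_const, smul_eq_mul, mul_comm]
  omega

theorem line_connected {V : Type} (G : SimpleGraph V) (hG : G.Connected)
    (hne : Nonempty G.edgeSet) : G.lineGraph.Connected := by
  have key : ∀ (a b : V) (w : G.Walk a b) (e f : G.edgeSet), a ∈ (e : Sym2 V) →
      b ∈ (f : Sym2 V) → G.lineGraph.Reachable e f := by
    intro a b w
    induction w with
    | nil =>
      intro e f he hf
      by_cases h : e = f
      · rw [h]
      · exact (lg_adj h he hf).reachable
    | @cons a c b h w ih =>
      intro e f he hf
      refine Reachable.trans ?_ (ih ⟨s(a, c), h⟩ f (by simp) hf)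
      by_cases hq : e = ⟨s(a, c), h⟩
      · rw [hq]
      · exact (lg_adj hq he (by simp)).reachable
  refine { preconnected := ?_, nonempty := hne }
  rintro ⟨e, he⟩ ⟨f, hf⟩
  induction e using Sym2.ind with
  | _ a b =>
    induction f using Sym2.ind with
    | _ c d =>
      obtain ⟨w⟩ := hG.preconnected a c
      exact key a c w _ _ (by simp) (by simp)

theorem noedge_traceable {V : Type} (G : SimpleGraph V) (hG : G.Connected)
    (hne : ¬ Nonempty G.edgeSet) : Traceable G := by
  obtain ⟨u⟩ := hG.nonempty
  refine ⟨u, u, Walk.nil, by simp, ?_⟩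
  intro w
  obtain ⟨p⟩ := hG.preconnected w u
  cases p with
  | nil => simp
  | cons h p => exact absurd ⟨⟨s(_, _), h⟩⟩ hne

theorem good_max {V : Type} [Finite V] {G : SimpleGraph V} {u v : V}
    (t : G.Walk u v) (ht : t.IsTrail)
    (hne : ∃ g : G.edgeSet, ∃ x ∈ t.support, x ∈ (g : Sym2 V)) :
    ∃ C : Set V, {x | x ∈ t.support} ⊆ C ∧ Good G C ∧
      ∀ c ∈ C, ∀ y, y ∉ C → G.Adj c y → gdeg G y < 3 := by
  obtain ⟨e, f, p, h1, h2, h3⟩ := good_path t ht hne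
  have h0 : {x | x ∈ t.support} ∈ {C : Set V | Good G C} := ⟨e, f, p, h1.isTrail, h2, h3⟩
  obtain ⟨C, hC1, hC2⟩ := (Set.toFinite {C : Set V | Good G C}).exists_le_maximal h0
  refine ⟨C, hC1, hC2.1, ?_⟩
  intro c hc y hy hadj
  by_contra hd
  have := hC2.2 (good_insert hC2.1 hc hy hadj (by omega)) (Set.subset_insert _ _)
  exact hy (this (Set.mem_insert _ _))

theorem main_step (k : ℕ) (ih : 0 < k → ∀ (V : Type) [Finite V] (G : SimpleGraph V),
    G.Connected → ∀ (u v : V) (t : G.Walk u v), t.IsTrail →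
    {x | gdeg G x < 3 ∧ x ∉ t.support}.ncard ≤ k - 1 →
    ∃ m ≤ k - 1 + 2, Traceable (iterLine ⟨V, G⟩ m).2)
    (V : Type) [Finite V] (G : SimpleGraph V) (hG : G.Connected)
    (u v : V) (t : G.Walk u v) (ht : t.IsTrail)
    (hk : {x | gdeg G x < 3 ∧ x ∉ t.support}.ncard ≤ k) :
    ∃ m ≤ k + 2, Traceable (iterLine ⟨V, G⟩ m).2 := by
  by_cases hE : Nonempty G.edgeSet
  swap
  · exact ⟨0, by omega, noedge_traceable G hG hE⟩
  have hL := line_connected G hG hE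
  have hne : ∃ g : G.edgeSet, ∃ x ∈ t.support, x ∈ (g : Sym2 V) := by
    obtain ⟨⟨e, he⟩⟩ := hE
    induction e using Sym2.ind with
    | _ a b =>
      obtain ⟨w⟩ := hG.preconnected u a
      cases w with
      | nil => exact ⟨⟨_, he⟩, u, by simp, by simp⟩
      | cons h w => exact ⟨⟨s(u, _), h⟩, u, by simp, by simp⟩
  obtain ⟨C, hC1, ⟨e, f, p, hp, hcov, -⟩, hcl⟩ := good_max t ht hne
  by_cases hC : ∃ x, x ∉ C
  · have hcount := count_low G hG C ⟨u, hC1 (by simp)⟩ hcl hC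
    have h1 : {x | gdeg G x < 3 ∧ x ∉ C}.ncard ≤ k := by
      refine le_trans (Set.ncard_le_ncard ?_ (Set.toFinite _)) hk
      rintro x ⟨hx1, hx2⟩
      exact ⟨hx1, fun h => hx2 (hC1 h)⟩
    have h2 : {e : G.edgeSet | gdeg G.lineGraph e < 3 ∧ e ∉ p.support}.ncard ≤ k - 1 := by
      refine le_trans (Set.ncard_le_ncard (t := {e : G.edgeSet | gdeg G.lineGraph e < 3 ∧
        ∀ x ∈ (e : Sym2 V), x ∉ C}) ?_ (Set.toFinite _)) (by omega)
      rintro g ⟨hg1, hg2⟩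
      exact ⟨hg1, fun x hx hxC => hg2 (hcov g ⟨x, hxC, hx⟩)⟩
    obtain ⟨m, hm, htr⟩ := ih (by omega) G.edgeSet G.lineGraph hL e f p hp h2
    refine ⟨m + 1, by omega, ?_⟩
    exact htr
  · push Not at hC
    have hspan : ∀ g, g ∈ p.support := by
      rintro ⟨g, hg⟩
      induction g using Sym2.ind with
      | _ a b => exact hcov _ ⟨a, hC a, by simp⟩
    by_cases hE2 : Nonempty G.lineGraph.edgeSet
    swap
    · exact ⟨1, by omega, noedge_traceable G.lineGraph hL hE2⟩
    have hall : ∀ g : G.lineGraph.edgeSet, ∃ x ∈ p.support, x ∈ (g : Sym2 G.edgeSet) := by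
      rintro ⟨g, hg⟩
      induction g using Sym2.ind with
      | _ a b => exact ⟨a, hspan a, by simp⟩
    obtain ⟨e', f', q, hq1, hq2, -⟩ := good_path p hp ⟨hE2.some, hall _⟩
    exact ⟨2, by omega, e', f', q, hq1, fun g => hq2 g (hall g)⟩

theorem main_aux (k : ℕ) : ∀ (V : Type) [Finite V] (G : SimpleGraph V), G.Connected →
    ∀ (u v : V) (t : G.Walk u v), t.IsTrail →
    {x | gdeg G x < 3 ∧ x ∉ t.support}.ncard ≤ k →
    ∃ m ≤ k + 2, Traceable (iterLine ⟨V, G⟩ m).2 := by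
  induction k with
  | zero =>
    intro V _ G hG u v t ht hk
    exact main_step 0 (fun h => absurd h (lt_irrefl 0)) V G hG u v t ht hk
  | succ k ih =>
    intro V _ G hG u v t ht hk
    exact main_step (k + 1) (fun _ => ih) V G hG u v t ht hk

/-- `h_p(G) ≤ n - mt*(G) - d*₍≥3₎(G) + 2`. -/
theorem stmt11 {V : Type} [Fintype V] [DecidableEq V] (G : SimpleGraph V)
    (hG : G.Connected) {u v : V} (t : G.Walk u v) (ht : t.IsTrail)
    (hmax : ∀ (a b : V) (s : G.Walk a b), s.IsTrail →
      s.support.toFinset.card ≤ t.support.toFinset.card)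
    (hmin : ∀ (a b : V) (s : G.Walk a b), s.IsTrail →
      s.support.toFinset.card = t.support.toFinset.card →
      ({w | 3 ≤ gdeg G w} \ {w | w ∈ t.support}).ncard ≤
        ({w | 3 ≤ gdeg G w} \ {w | w ∈ s.support}).ncard) :
    hp G ≤ Fintype.card V - t.support.toFinset.card -
      ({w | 3 ≤ gdeg G w} \ {w | w ∈ t.support}).ncard + 2 := by
  have hsup : t.support.toFinset.card = {w | w ∈ t.support}.ncard := by
    rw [← Set.ncard_coe_finset]
    congr 1
    ext; simp
  have hk : {x | gdeg G x < 3 ∧ x ∉ t.support}.ncard ≤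
      Fintype.card V - t.support.toFinset.card -
        ({w | 3 ≤ gdeg G w} \ {w | w ∈ t.support}).ncard := by
    have h1 : ({w | 3 ≤ gdeg G w} \ {w | w ∈ t.support}) ∪ {x | gdeg G x < 3 ∧ x ∉ t.support}
        = {w | w ∈ t.support}ᶜ := by
      ext x
      simp only [Set.mem_union, Set.mem_sdiff, Set.mem_ofPred_eq, Set.mem_compl_iff]
      have := lt_or_ge (gdeg G x) 3
      tauto
    have h2 : Disjoint ({w | 3 ≤ gdeg G w} \ {w | w ∈ t.support})
        {x | gdeg G x < 3 ∧ x ∉ t.support} := by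
      rw [Set.disjoint_left]
      rintro x ⟨hx, -⟩ ⟨hx2, -⟩
      exact absurd hx2 (not_lt.2 hx)
    have h3 := Set.ncard_union_eq h2 (Set.toFinite _) (Set.toFinite _)
    have h4 := Set.ncard_add_ncard_compl {w | w ∈ t.support}
    rw [h1] at h3
    rw [Nat.card_eq_fintype_card] at h4
    omega
  obtain ⟨m, hm, htr⟩ := main_aux _ V G hG u v t ht hk
  exact le_trans (Nat.sInf_le htr) hm
end Paper
end

section
/- Let G be a connected graph of order n and let mt*(G) be the maximum number of vertices on a trail of G. Then h_p(G) ≤ max{1, n − mt*(G)}. -/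
open SimpleGraph

namespace Paper

/-- The maximum number of vertices on a trail of `G`. -/
noncomputable def mtStar {V : Type} [Fintype V] [DecidableEq V] (G : SimpleGraph V) : ℕ :=
  sSup {m | ∃ (u v : V) (t : G.Walk u v), t.IsTrail ∧ t.support.toFinset.card = m}

/-- The spanning subgraph of the line graph keeping only adjacencies through a vertex of `A`. -/
def lineAt {V : Type*} (G : SimpleGraph V) (A : Set V) : SimpleGraph G.edgeSet where
  Adj e f := e ≠ f ∧ ∃ v ∈ A, v ∈ (e : Sym2 V) ∧ v ∈ (f : Sym2 V)
  symm := ⟨fun _ _ ⟨h, v, hv, h1, h2⟩ => ⟨h.symm, v, hv, h2, h1⟩⟩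

lemma lineAt_le {V : Type*} (G : SimpleGraph V) (A : Set V) : lineAt G A ≤ G.lineGraph := by
  intro e f ⟨h, v, _, h1, h2⟩
  exact lineGraph_adj_iff_exists.2 ⟨h, v, h1, h2⟩

lemma lineAt_mono {V : Type*} (G : SimpleGraph V) {A B : Set V} (h : A ⊆ B) :
    lineAt G A ≤ lineAt G B := by
  intro e f ⟨hn, v, hv, h1, h2⟩
  exact ⟨hn, v, h hv, h1, h2⟩

lemma chain_star {V : Type*} (G : SimpleGraph V) (A : Set V) (u : V) (hu : u ∈ A)
    (l : List G.edgeSet) (hl : l.Nodup) (h : ∀ e ∈ l, u ∈ (e : Sym2 V)) :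
    l.IsChain (lineAt G A).Adj := by
  apply List.Pairwise.isChain
  refine List.Pairwise.imp_of_mem ?_ hl
  intro a b ha hb hab
  exact ⟨hab, u, hu, h a ha, h b hb⟩

open Classical in
lemma pathList {V : Type*} (G : SimpleGraph V) {u v : V} (T : G.Walk u v) (hT : T.IsTrail) :
    ∀ D : Finset G.edgeSet, (∀ e : G.edgeSet, e.1 ∈ T.edges → e ∈ D) →
    ∃ l : List G.edgeSet, l.Nodup ∧
      (∀ e, e ∈ l ↔ e ∈ D ∧ ∃ x ∈ T.support, x ∈ (e : Sym2 V)) ∧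
      l.IsChain (lineAt G {x | x ∈ T.support}).Adj ∧ ∀ e ∈ l.head?, u ∈ (e : Sym2 V) := by
  induction T with
  | nil =>
    rename_i u
    intro D _
    refine ⟨(D.filter (fun e : G.edgeSet => u ∈ (e : Sym2 V))).toList, Finset.nodup_toList _, ?_, ?_, ?_⟩
    · simp
    · apply chain_star G _ u (by simp) _ (Finset.nodup_toList _)
      simp
    · intro e he
      have := List.mem_of_mem_head? he
      simp at this
      exact this.2
  | cons h T' ih =>
    rename_i u w v
    rw [Walk.isTrail_cons] at hT
    intro D hD
    let e0 : G.edgeSet := ⟨s(u, w), h⟩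
    let D1 := D.filter (fun e : G.edgeSet => u ∈ (e : Sym2 V) ∧ e.1 ∉ T'.edges ∧ e ≠ e0)
    let D' := D.filter (fun e : G.edgeSet => e ∉ D1 ∧ e ≠ e0)
    obtain ⟨l', hn, hm, hc, hh⟩ := ih hT.1 D' (by
      intro e he
      have : e ∈ D := hD e (by simp [he])
      have h0 : e ≠ e0 := by
        rintro rfl
        exact hT.2 he
      simp [D', D1, this, he, h0])
    have he0 : e0 ∈ D := hD e0 (by simp [e0])
    have hD1 : ∀ e ∈ D1.toList ++ [e0], u ∈ (e : Sym2 V) := by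
      intro e he
      simp [D1] at he
      rcases he with he | rfl
      · exact he.2.1
      · simp [e0]
    have hnd : (D1.toList ++ [e0]).Nodup := by
      rw [List.nodup_append]
      refine ⟨Finset.nodup_toList _, by simp, ?_⟩
      simp only [Finset.mem_toList, List.mem_singleton]
      rintro a ha b rfl rfl
      simp [D1] at ha
    refine ⟨(D1.toList ++ [e0]) ++ l', ?_, ?_, ?_, ?_⟩
    · rw [List.nodup_append]
      refine ⟨hnd, hn, ?_⟩
      rintro a ha b hb rfl
      rw [hm] at hb
      simp only [List.mem_append, Finset.mem_toList, List.mem_singleton] at ha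
      have := hb.1
      simp only [D', Finset.mem_filter] at this
      tauto
    · intro e
      simp only [List.mem_append, Finset.mem_toList, hm, Walk.support_cons,
        List.mem_cons, List.not_mem_nil, or_false]
      constructor
      · rintro ((he | rfl) | he)
        · simp only [D1, Finset.mem_filter] at he
          exact ⟨he.1, u, Or.inl rfl, he.2.1⟩
        · exact ⟨he0, u, Or.inl rfl, by simp [e0]⟩
        · obtain ⟨h1, x, hx, hxe⟩ := he
          simp only [D', Finset.mem_filter] at h1
          exact ⟨h1.1, x, Or.inr hx, hxe⟩
      · rintro ⟨heD, x, hx, hxe⟩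
        by_cases h0 : e = e0
        · exact Or.inl (Or.inr h0)
        by_cases h1 : e ∈ D1
        · exact Or.inl (Or.inl h1)
        right
        refine ⟨by simp only [D', Finset.mem_filter]; exact ⟨heD, h1, h0⟩, ?_⟩
        rcases hx with rfl | hx
        · have : e.1 ∈ T'.edges := by
            by_contra hne
            exact h1 (by simp only [D1, Finset.mem_filter]; exact ⟨heD, hxe, hne, h0⟩)
          obtain ⟨⟨a, b⟩, hab⟩ := e
          exact ⟨a, Walk.fst_mem_support_of_mem_edges _ this, by simp⟩
        · exact ⟨x, hx, hxe⟩
    · rw [List.isChain_append]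
      refine ⟨chain_star G _ u (by simp) _ hnd hD1, ?_, ?_⟩
      · refine hc.imp ?_
        intro a b hab
        exact lineAt_mono G (by intro x hx; simp at hx ⊢; exact Or.inr hx) hab
      · intro a ha b hb
        simp at ha
        subst ha
        refine ⟨?_, w, by simp, by simp [e0], hh b hb⟩
        rintro rfl
        have := ((hm _).1 (List.mem_of_mem_head? hb)).1
        simp [D'] at this
    · intro e he
      apply hD1
      rw [List.head?_append] at he
      have : (D1.toList ++ [e0]).head? ≠ none := by simp
      obtain ⟨z, hz⟩ := Option.ne_none_iff_exists'.1 this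
      rw [hz] at he
      simp at he
      subst he
      exact List.mem_of_mem_head? hz

/-- A path in the line graph through all edges meeting a given trail. -/
lemma exists_path {V : Type*} [Finite V] (G : SimpleGraph V) {u v : V} (T : G.Walk u v)
    (hT : T.IsTrail) (hne : ∃ e : G.edgeSet, ∃ x ∈ T.support, x ∈ (e : Sym2 V)) :
    ∃ (a b : G.edgeSet) (q : (lineAt G {x | x ∈ T.support}).Walk a b), q.IsPath ∧
      ∀ e : G.edgeSet, (∃ x ∈ T.support, x ∈ (e : Sym2 V)) → e ∈ q.support := by
  classical
  have := Fintype.ofFinite G.edgeSet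
  obtain ⟨l, hn, hm, hc, -⟩ := pathList G T hT Finset.univ (by simp)
  have hl : l ≠ [] := by
    obtain ⟨e, he⟩ := hne
    exact List.ne_nil_of_mem ((hm e).2 ⟨by simp, he⟩)
  refine ⟨_, _, Walk.ofSupport l hl hc, ?_, ?_⟩
  · rw [Walk.isPath_def, Walk.support_ofSupport]; exact hn
  · intro e he
    rw [Walk.support_ofSupport]
    exact (hm e).2 ⟨by simp, he⟩

/-- Splicing a closed trail into a trail. -/
lemma splice {V : Type*} {G : SimpleGraph V} {a b c : V} (p : G.Walk a b) (hp : p.IsTrail)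
    (q : G.Walk c c) (hq : q.IsTrail) (hc : c ∈ p.support)
    (hd : ∀ e, e ∈ p.edges → e ∉ q.edges) :
    ∃ r : G.Walk a b, r.IsTrail ∧ ∀ x, x ∈ p.support ∨ x ∈ q.support → x ∈ r.support := by
  classical
  have hs := p.take_spec hc
  refine ⟨(p.takeUntil c hc).append (q.append (p.dropUntil c hc)), ?_, ?_⟩
  · have hp' := hp
    rw [← hs, Walk.isTrail_append] at hp'
    rw [Walk.isTrail_append, Walk.isTrail_append]
    have h1 := p.edges_takeUntil_subset_edges hc
    have h2 := p.edges_dropUntil_subset_edges hc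
    refine ⟨hp'.1, ⟨hq, hp'.2.1, ?_⟩, ?_⟩
    · intro e he he'
      exact hd e (h2 he') he
    · intro e he he'
      rw [Walk.edges_append, List.mem_append] at he'
      rcases he' with he' | he'
      · exact hd e (h1 he) he'
      · exact hp'.2.2 he he'
  · intro x hx
    rw [← hs, Walk.mem_support_append_iff] at hx
    rw [Walk.mem_support_append_iff, Walk.mem_support_append_iff]
    tauto

open Classical in
/-- The edges at a vertex. -/
noncomputable def inc {V : Type*} (G : SimpleGraph V) [Fintype G.edgeSet] (v : V) :
    Finset G.edgeSet := Finset.univ.filter (fun e => v ∈ (e : Sym2 V))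

lemma mem_inc {V : Type*} (G : SimpleGraph V) [Fintype G.edgeSet] (v : V) (e : G.edgeSet) :
    e ∈ inc G v ↔ v ∈ (e : Sym2 V) := by simp [inc]

lemma card_inc {V : Type*} (G : SimpleGraph V) [Fintype G.edgeSet] (v : V) :
    (inc G v).card = gdeg G v := by
  classical
  rw [gdeg, ← Set.ncard_coe_finset]
  symm
  refine Set.ncard_congr (fun w hw => ⟨s(v, w), hw⟩) ?_ ?_ ?_
  · intro w hw
    simp [mem_inc]
  · intro a b ha hb hab
    have := congrArg Subtype.val hab
    simp at this
    rcases this with h | h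
    · exact h
    · exact h.2.trans h.1
  · rintro ⟨e, he⟩ hv
    simp only [Finset.mem_coe, mem_inc] at hv
    obtain ⟨w, rfl⟩ := Sym2.mem_iff_exists.1 hv
    exact ⟨w, he, rfl⟩

lemma eq_of_two {V : Type*} {G : SimpleGraph V} {a b : V} (hab : a ≠ b) {e f : G.edgeSet}
    (h1 : a ∈ (e : Sym2 V)) (h2 : b ∈ (e : Sym2 V)) (h3 : a ∈ (f : Sym2 V))
    (h4 : b ∈ (f : Sym2 V)) : e = f := by
  apply Subtype.ext
  rw [(Sym2.mem_and_mem_iff hab).1 ⟨h1, h2⟩, (Sym2.mem_and_mem_iff hab).1 ⟨h3, h4⟩]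

lemma gdeg_line {V : Type*} [Finite V] (G : SimpleGraph V) {a b : V} (h : G.Adj a b) :
    gdeg G.lineGraph ⟨s(a, b), h⟩ + 2 = gdeg G a + gdeg G b := by
  classical
  have := Fintype.ofFinite G.edgeSet
  set e : G.edgeSet := ⟨s(a, b), h⟩ with he
  rw [← card_inc G a, ← card_inc G b, ← Finset.card_union_add_card_inter]
  have h1 : inc G a ∩ inc G b = {e} := by
    ext f
    simp only [Finset.mem_inter, mem_inc, Finset.mem_singleton]
    constructor
    · intro ⟨h1, h2⟩
      exact eq_of_two h.ne h1 h2 (by simp [e]) (by simp [e])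
    · rintro rfl
      simp [e]
  have h2 : ((inc G a ∪ inc G b : Finset _) : Set G.edgeSet)
      = insert e (G.lineGraph.neighborSet e) := by
    ext f
    simp only [Finset.coe_union, Set.mem_union, Finset.mem_coe, mem_inc, Set.mem_insert_iff,
      mem_neighborSet, lineGraph_adj_iff_exists]
    constructor
    · intro hf
      by_cases hfe : f = e
      · exact Or.inl hfe
      · right
        refine ⟨fun h => hfe h.symm, ?_⟩
        rcases hf with hf | hf
        · exact ⟨a, by simp [e], hf⟩
        · exact ⟨b, by simp [e], hf⟩
    · rintro (rfl | ⟨_, v, hv, hf⟩)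
      · simp [e]
      · simp only [e, Sym2.mem_iff] at hv
        rcases hv with rfl | rfl
        · exact Or.inl hf
        · exact Or.inr hf
  rw [h1, ← Set.ncard_coe_finset (inc G a ∪ inc G b), h2, Set.ncard_insert_of_notMem (by simp)]
  simp [gdeg]

/-- In the clique of edges at a vertex of degree at least three there is a closed trail. -/
lemma clique_trail {V : Type*} [Finite V] (G : SimpleGraph V) (x : V) (hx : 3 ≤ gdeg G x)
    (e : G.edgeSet) (he : x ∈ (e : Sym2 V)) :
    ∃ q : (lineAt G {x}).Walk e e, q.IsTrail ∧
      ∀ f : G.edgeSet, x ∈ (f : Sym2 V) → f ∈ q.support := by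
  classical
  have := Fintype.ofFinite G.edgeSet
  have hm : ∀ f, f ∈ e :: ((inc G x).erase e).toList ↔ x ∈ (f : Sym2 V) := by
    intro f
    simp only [List.mem_cons, Finset.mem_toList, Finset.mem_erase, mem_inc]
    constructor
    · rintro (rfl | h)
      · exact he
      · exact h.2
    · intro h
      by_cases hf : f = e
      · exact Or.inl hf
      · exact Or.inr ⟨hf, h⟩
  have hnd : (e :: ((inc G x).erase e).toList).Nodup := by
    rw [List.nodup_cons]
    exact ⟨by simp, Finset.nodup_toList _⟩
  have hlen : ((inc G x).erase e).toList.length + 1 = gdeg G x := by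
    rw [Finset.length_toList, Finset.card_erase_add_one ((mem_inc _ _ _).2 he), card_inc]
  have hch := chain_star G {x} x rfl _ hnd (fun f hf => (hm f).1 hf)
  revert hm hnd hlen hch
  generalize ((inc G x).erase e).toList = l
  intro hm hnd hlen hch
  match l, hm, hnd, hlen, hch with
  | [], _, _, hlen, _ => simp at hlen; omega
  | [_], _, _, hlen, _ => simp at hlen; omega
  | f :: g :: l, hm, hnd, hlen, hch =>
    have hch' := hch.of_cons
    obtain ⟨c, p, hps⟩ : ∃ (c : G.edgeSet) (p : (lineAt G {x}).Walk f c),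
        p.support = f :: g :: l :=
      ⟨_, Walk.ofSupport (f :: g :: l) (by simp) hch', Walk.support_ofSupport _ _⟩
    have hpp : p.IsPath := by
      rw [Walk.isPath_def, hps]
      exact hnd.of_cons
    have hlast : c ∈ (g :: l) := by
      have h1 := p.getLast_support
      simp only [hps] at h1
      rw [← h1, List.getLast_cons (by simp)]
      exact List.getLast_mem _
    have hef : (lineAt G {x}).Adj e f := hch.rel
    have hne : c ≠ e := by
      intro h
      have h2 := (List.nodup_cons.1 hnd).1
      rw [h] at hlast
      exact h2 (List.mem_cons_of_mem _ hlast)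
    have hnf : c ≠ f := by
      intro h
      have h2 := (List.nodup_cons.1 (List.nodup_cons.1 hnd).2).1
      rw [h] at hlast
      exact h2 hlast
    have hle : (lineAt G {x}).Adj c e :=
      ⟨hne, x, rfl, (hm _).1 (List.mem_cons_of_mem _ (List.mem_cons_of_mem _ hlast)), he⟩
    have hep : e ∉ p.support := by
      rw [hps]; exact (List.nodup_cons.1 hnd).1
    refine ⟨Walk.cons hef (p.concat hle), ?_, ?_⟩
    · rw [Walk.isTrail_cons]
      constructor
      · rw [Walk.isTrail_def, Walk.edges_concat, List.concat_eq_append, List.nodup_append]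
        refine ⟨hpp.isTrail.edges_nodup, by simp, ?_⟩
        rintro a ha b hb rfl
        simp only [List.mem_singleton] at hb
        subst hb
        exact hep (Walk.snd_mem_support_of_mem_edges _ ha)
      · rw [Walk.edges_concat, List.concat_eq_append, List.mem_append]
        rintro (h | h)
        · exact hep (Walk.fst_mem_support_of_mem_edges _ h)
        · simp only [List.mem_singleton, Sym2.eq_iff] at h
          rcases h with h | h
          · exact hne h.1.symm
          · exact hnf h.2.symm
    · intro z hz
      have := (hm z).2 hz
      rw [Walk.support_cons, Walk.support_concat, hps]
      simp only [List.mem_cons, List.concat_eq_append, List.mem_append] at this ⊢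
      tauto

/-- The trail can absorb a vertex of degree at least three adjacent to it. -/
lemma absorb {V : Type*} [Finite V] (G : SimpleGraph V) (A : Set V) (x y : V) (hx : x ∉ A)
    (hd : 3 ≤ gdeg G x) (hy : y ∈ A) (hxy : G.Adj x y)
    (hA : ∃ (a b : G.edgeSet) (q : (lineAt G A).Walk a b), q.IsTrail ∧
      ∀ e : G.edgeSet, (∃ x ∈ A, x ∈ (e : Sym2 V)) → e ∈ q.support) :
    ∃ (a b : G.edgeSet) (q : (lineAt G (insert x A)).Walk a b), q.IsTrail ∧
      ∀ e : G.edgeSet, (∃ z ∈ insert x A, z ∈ (e : Sym2 V)) → e ∈ q.support := by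
  obtain ⟨a, b, q, hq, hs⟩ := hA
  obtain ⟨c, hc, hcs⟩ := clique_trail G x hd ⟨s(x, y), hxy⟩ (by simp)
  have l1 : lineAt G A ≤ lineAt G (insert x A) := lineAt_mono G (by simp)
  have l2 : lineAt G {x} ≤ lineAt G (insert x A) := lineAt_mono G (by simp)
  obtain ⟨r, hr, hrs⟩ := splice (q.mapLe l1) (hq.mapLe l1) (c.mapLe l2) (hc.mapLe l2)
    (by
      rw [Walk.support_mapLe_eq_support]
      exact hs _ ⟨y, hy, by simp⟩)
    (by
      intro e he he'
      rw [Walk.edges_mapLe_eq_edges] at he he'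
      induction e with
      | _ e f =>
        obtain ⟨hn, v, hv, h1, h2⟩ := Walk.adj_of_mem_edges _ he
        obtain ⟨_, w, rfl, h3, h4⟩ := Walk.adj_of_mem_edges _ he'
        refine hn (eq_of_two (a := v) (b := w) ?_ h1 h3 h2 h4)
        rintro rfl
        exact hx hv)
  refine ⟨a, b, r, hr, ?_⟩
  rintro e ⟨z, hz, hze⟩
  apply hrs
  rw [Walk.support_mapLe_eq_support, Walk.support_mapLe_eq_support]
  rcases hz with rfl | hz
  · exact Or.inr (hcs _ hze)
  · exact Or.inl (hs _ ⟨z, hz, hze⟩)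

lemma exists_maximal {V : Type*} [Finite V] (G : SimpleGraph V) {u v : V} (T : G.Walk u v)
    (hT : T.IsTrail) (hne : ∃ e : G.edgeSet, ∃ x ∈ T.support, x ∈ (e : Sym2 V)) :
    ∃ A : Set V, (∀ x ∈ T.support, x ∈ A) ∧
      (∀ x y, x ∉ A → y ∈ A → G.Adj x y → gdeg G x ≤ 2) ∧
      ∃ (a b : G.edgeSet) (q : G.lineGraph.Walk a b), q.IsTrail ∧
      ∀ e : G.edgeSet, (∃ x ∈ A, x ∈ (e : Sym2 V)) → e ∈ q.support := by
  let P : Set V → Prop := fun A => (∀ x ∈ T.support, x ∈ A) ∧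
    ∃ (a b : G.edgeSet) (q : (lineAt G A).Walk a b), q.IsTrail ∧
      ∀ e : G.edgeSet, (∃ x ∈ A, x ∈ (e : Sym2 V)) → e ∈ q.support
  have h0 : P {x | x ∈ T.support} := by
    obtain ⟨a, b, q, hq, hs⟩ := exists_path G T hT hne
    exact ⟨fun x hx => hx, a, b, q, hq.isTrail, hs⟩
  obtain ⟨A, hA⟩ := (Set.toFinite {A | P A}).exists_maximal ⟨_, h0⟩
  obtain ⟨hTA, hq⟩ := hA.prop
  refine ⟨A, hTA, ?_, ?_⟩
  · intro x y hx hy hxy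
    by_contra hd
    have := absorb G A x y hx (by omega) hy hxy hq
    have h2 : P (insert x A) := ⟨fun z hz => Or.inr (hTA z hz), this⟩
    exact hx (hA.le_of_ge h2 (Set.subset_insert _ _) (Set.mem_insert _ _))
  · obtain ⟨a, b, q, hq, hs⟩ := hq
    refine ⟨a, b, q.mapLe (lineAt_le G A), hq.mapLe _, ?_⟩
    intro e he
    rw [Walk.support_mapLe_eq_support]
    exact hs e he

lemma boundary {V : Type*} (G : SimpleGraph V) (hG : G.Preconnected) (A : Set V) {a b : V}
    (ha : a ∈ A) (hb : b ∉ A) : ∃ x y, x ∉ A ∧ y ∈ A ∧ G.Adj x y := by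
  obtain ⟨p⟩ := hG a b
  induction p with
  | nil => exact absurd ha hb
  | cons h p ih =>
    rename_i u v w
    by_cases hv : v ∈ A
    · exact ih hv hb
    · exact ⟨v, u, hv, ha, h.symm⟩

lemma line_preconnected {V : Type*} (G : SimpleGraph V) (hG : G.Preconnected) :
    G.lineGraph.Preconnected := by
  have key : ∀ (a b : V) (p : G.Walk a b) (e f : G.edgeSet), a ∈ (e : Sym2 V) →
      b ∈ (f : Sym2 V) → G.lineGraph.Reachable e f := by
    intro a b p
    induction p with
    | nil =>
      intro e f he hf
      by_cases h : e = f
      · rw [h]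
      · exact (lineGraph_adj_iff_exists.2 ⟨h, _, he, hf⟩ : G.lineGraph.Adj e f).reachable
    | cons h p ih =>
      rename_i u v w
      intro e f he hf
      have h1 := ih ⟨s(u, v), h⟩ f (by simp) hf
      refine Reachable.trans ?_ h1
      by_cases h' : e = ⟨s(u, v), h⟩
      · rw [h']
      · exact (lineGraph_adj_iff_exists.2 ⟨h', u, he, by simp⟩ :
          G.lineGraph.Adj e ⟨s(u, v), h⟩).reachable
  rintro ⟨⟨a, b⟩, h⟩ ⟨⟨c, d⟩, h'⟩
  obtain ⟨p⟩ := hG a c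
  exact key a c p _ _ (by simp) (by simp)

open Classical in
lemma tokens {V : Type*} [Fintype V] (G : SimpleGraph V) [Fintype G.edgeSet] (W : Finset V)
    (x y : V) (hx : x ∈ W) (hy : y ∉ W) (hxy : G.Adj x y) (hd : gdeg G x ≤ 2)
    (EW : Finset G.edgeSet) (hEW : ∀ e ∈ EW, ∀ v ∈ (e : Sym2 V), v ∈ W) :
    2 * (EW.filter (fun e : G.edgeSet => gdeg G.lineGraph e ≤ 2)).card +
      (EW.filter (fun e : G.edgeSet => ¬ gdeg G.lineGraph e ≤ 2 ∧ ∃ v ∈ (e : Sym2 V), gdeg G v ≤ 2)).card + 1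
      ≤ 2 * (W.filter (fun v => gdeg G v ≤ 2)).card := by
  set LW := W.filter (fun v => gdeg G v ≤ 2) with hLW
  let t : V → ℕ := fun v => if gdeg G v = 1 then 2 else 1
  have hxL : x ∈ LW := by simp [hLW, hx, hd]
  have e1 : 2 * (EW.filter (fun e : G.edgeSet => gdeg G.lineGraph e ≤ 2)).card +
      (EW.filter (fun e : G.edgeSet => ¬ gdeg G.lineGraph e ≤ 2 ∧ ∃ v ∈ (e : Sym2 V), gdeg G v ≤ 2)).card
      = ∑ e ∈ EW, (2 * (if gdeg G.lineGraph e ≤ 2 then 1 else 0) +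
        (if ¬ gdeg G.lineGraph e ≤ 2 ∧ ∃ v ∈ (e : Sym2 V), gdeg G v ≤ 2 then 1 else 0)) := by
    rw [Finset.sum_add_distrib, ← Finset.mul_sum, Finset.card_filter, Finset.card_filter]
  have e2 : ∀ e ∈ EW, (2 * (if gdeg G.lineGraph e ≤ 2 then 1 else 0) +
        (if ¬ gdeg G.lineGraph e ≤ 2 ∧ ∃ v ∈ (e : Sym2 V), gdeg G v ≤ 2 then 1 else 0))
      ≤ ∑ v ∈ LW, if v ∈ (e : Sym2 V) then t v else 0 := by
    rintro ⟨⟨a, b⟩, hab⟩ he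
    have hab' : G.Adj a b := hab
    have ha : a ∈ W := hEW _ he a (by simp)
    have hb : b ∈ W := hEW _ he b (by simp)
    have hdeg := gdeg_line G hab'
    change (2 * (if gdeg G.lineGraph ⟨s(a, b), hab⟩ ≤ 2 then 1 else 0) +
        (if ¬ gdeg G.lineGraph ⟨s(a, b), hab⟩ ≤ 2 ∧ ∃ v ∈ s(a, b), gdeg G v ≤ 2 then 1 else 0))
      ≤ ∑ v ∈ LW, if v ∈ s(a, b) then t v else 0
    have hs : ∑ v ∈ LW, (if v ∈ s(a, b) then t v else 0)
        = (if gdeg G a ≤ 2 then t a else 0) + (if gdeg G b ≤ 2 then t b else 0) := by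
      have : ∀ v ∈ LW, (if v ∈ s(a, b) then t v else 0)
          = (if v = a then t v else 0) + (if v = b then t v else 0) := by
        intro v _
        have := hab'.ne
        by_cases h1 : v = a <;> by_cases h2 : v = b <;> simp_all
      rw [Finset.sum_congr rfl this, Finset.sum_add_distrib, Finset.sum_ite_eq',
        Finset.sum_ite_eq']
      simp [hLW, ha, hb]
    rw [hs]
    have hex : (∃ v ∈ s(a, b), gdeg G v ≤ 2) ↔ gdeg G a ≤ 2 ∨ gdeg G b ≤ 2 := by simp
    simp only [hex]
    have pa : 1 ≤ gdeg G a := by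
      rw [gdeg, Nat.succ_le_iff, Set.ncard_pos]
      exact ⟨b, hab'⟩
    have pb : 1 ≤ gdeg G b := by
      rw [gdeg, Nat.succ_le_iff, Set.ncard_pos]
      exact ⟨a, hab'.symm⟩
    simp only [t]
    split_ifs <;> omega
  have e3 : ∀ v ∈ LW, ∑ e ∈ EW, (if v ∈ (e : Sym2 V) then t v else 0)
      ≤ if v = x then 1 else 2 := by
    intro v hv
    have hv2 : gdeg G v ≤ 2 := (Finset.mem_filter.1 hv).2
    have hc : (EW.filter (fun e : G.edgeSet => v ∈ (e : Sym2 V))).card + (if v = x then 1 else 0)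
        ≤ gdeg G v := by
      rw [← card_inc]
      split_ifs with hvx
      · subst hvx
        refine Finset.card_lt_card ?_
        rw [Finset.ssubset_iff_of_subset]
        · refine ⟨⟨s(v, y), hxy⟩, by simp [mem_inc], ?_⟩
          intro h
          exact hy (hEW _ (Finset.mem_filter.1 h).1 y (by simp))
        · intro e he
          rw [mem_inc]
          exact (Finset.mem_filter.1 he).2
      · refine Finset.card_le_card ?_
        intro e he
        rw [mem_inc]
        exact (Finset.mem_filter.1 he).2
    rw [← Finset.sum_filter, Finset.sum_const, smul_eq_mul]
    simp only [t]
    split_ifs at hc ⊢ <;> omega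
  have e4 : (∑ v ∈ LW, if v = x then 1 else 2) + 1 = 2 * LW.card := by
    have : ∀ v ∈ LW, (if v = x then 1 else 2) + (if v = x then 1 else 0) = 2 := by
      intro v _
      split_ifs <;> rfl
    have h2 := Finset.sum_congr rfl this
    rw [Finset.sum_add_distrib, Finset.sum_ite_eq', if_pos hxL, Finset.sum_const, smul_eq_mul]
      at h2
    omega
  rw [e1, ← e4]
  refine Nat.add_le_add_right ?_ 1
  refine (Finset.sum_le_sum e2).trans ?_
  rw [Finset.sum_comm]
  exact Finset.sum_le_sum e3

open Classical in
/-- Number of vertices of degree at most two off `S`. -/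
noncomputable def lowc {V : Type} [Fintype V] (G : SimpleGraph V) (S : Set V) : ℕ :=
  (Finset.univ.filter (fun x => x ∉ S ∧ gdeg G x ≤ 2)).card

open Classical in
/-- Number of vertices of degree at least three off `S`. -/
noncomputable def highc {V : Type} [Fintype V] (G : SimpleGraph V) (S : Set V) : ℕ :=
  (Finset.univ.filter (fun x => x ∉ S ∧ ¬ gdeg G x ≤ 2)).card

lemma lowc_mono {V : Type} [Fintype V] (G : SimpleGraph V) {S S' : Set V} (h : S ⊆ S') :
    lowc G S' ≤ lowc G S := by
  apply Finset.card_le_card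
  intro x hx
  simp at hx ⊢
  exact ⟨fun h' => hx.1 (h h'), hx.2⟩

lemma highc_mono {V : Type} [Fintype V] (G : SimpleGraph V) {S S' : Set V} (h : S ⊆ S') :
    highc G S' ≤ highc G S := by
  apply Finset.card_le_card
  intro x hx
  simp at hx ⊢
  exact ⟨fun h' => hx.1 (h h'), hx.2⟩

lemma lowc_add_highc {V : Type} [Fintype V] [DecidableEq V] (G : SimpleGraph V) (S : Finset V) :
    lowc G (S : Set V) + highc G (S : Set V) + S.card = Fintype.card V := by
  classical
  have h1 : lowc G (S : Set V) + highc G (S : Set V) = Sᶜ.card := by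
    rw [← Finset.card_filter_add_card_filter_not (s := Sᶜ) (fun x => gdeg G x ≤ 2)]
    unfold lowc highc
    congr 2 <;> (ext; simp)
  rw [h1, Finset.card_compl]
  have := Finset.card_le_univ S
  omega

lemma count_step {V : Type} [Fintype V] (G : SimpleGraph V) [Fintype G.edgeSet] (A : Set V)
    (B : Set G.edgeSet) (hB : ∀ e : G.edgeSet, (∃ x ∈ A, x ∈ (e : Sym2 V)) → e ∈ B)
    (x y : V) (hx : x ∉ A) (hy : y ∈ A) (hxy : G.Adj x y) (hd : gdeg G x ≤ 2) :
    lowc G.lineGraph B + min 2 (highc G.lineGraph B) + 1 ≤ lowc G A + min 2 (highc G A) := by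
  classical
  let W : Finset V := Finset.univ.filter (fun v => v ∉ A)
  let EW : Finset G.edgeSet := Finset.univ.filter (fun e => e ∉ B)
  have hEW : ∀ e ∈ EW, ∀ v ∈ (e : Sym2 V), v ∈ W := by
    intro e he v hv
    simp only [EW, W, Finset.mem_filter, Finset.mem_univ, true_and] at he ⊢
    intro hA
    exact he (hB e ⟨v, hA, hv⟩)
  have h := tokens G W x y (by simpa [W] using hx) (by simpa [W] using hy) hxy hd EW hEW
  have h1 : (EW.filter (fun e : G.edgeSet => gdeg G.lineGraph e ≤ 2)).card = lowc G.lineGraph B := by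
    unfold lowc; congr 1; ext; simp [EW]
  have h2 : (W.filter (fun e => gdeg G e ≤ 2)).card = lowc G A := by
    unfold lowc; congr 1; ext; simp [W]
  rw [h1, h2] at h
  by_cases c2 : 2 ≤ highc G A
  · omega
  have key : highc G.lineGraph B ≤ (EW.filter (fun e : G.edgeSet => ¬ gdeg G.lineGraph e ≤ 2 ∧
      ∃ v ∈ (e : Sym2 V), gdeg G v ≤ 2)).card := by
    unfold highc
    apply Finset.card_le_card
    rintro ⟨⟨a, b⟩, hab⟩ he
    simp only [Finset.mem_filter, Finset.mem_univ, true_and] at he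
    have heE : (⟨s(a, b), hab⟩ : G.edgeSet) ∈ EW := 
      Finset.mem_filter.2 ⟨Finset.mem_univ _, he.1⟩
    refine Finset.mem_filter.2 ⟨heE, he.2, ?_⟩
    by_contra hno
    push Not at hno
    have ha := hno a (by simp)
    have hb := hno b (by simp)
    have haW := hEW _ heE a (by simp)
    have hbW := hEW _ heE b (by simp)
    apply c2
    have hne : a ≠ b := (show G.Adj a b from hab).ne
    rw [← Finset.card_pair hne]
    unfold highc
    apply Finset.card_le_card
    intro z hz
    simp only [W, Finset.mem_filter, Finset.mem_univ, true_and] at haW hbW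
    simp only [Finset.mem_insert, Finset.mem_singleton] at hz
    simp only [Finset.mem_filter, Finset.mem_univ, true_and]
    rcases hz with rfl | rfl
    · exact ⟨haW, by omega⟩
    · exact ⟨hbW, by omega⟩
  by_cases c0 : highc G A = 0
  · have : highc G.lineGraph B = 0 := by
      unfold highc
      rw [Finset.card_eq_zero, Finset.filter_eq_empty_iff]
      rintro ⟨⟨a, b⟩, hab⟩ - ⟨he, hdeg⟩
      have heE : (⟨s(a, b), hab⟩ : G.edgeSet) ∈ EW := 
      Finset.mem_filter.2 ⟨Finset.mem_univ _, he⟩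
      have haW := hEW _ heE a (by simp)
      have hbW := hEW _ heE b (by simp)
      simp only [W, Finset.mem_filter, Finset.mem_univ, true_and] at haW hbW
      unfold highc at c0
      rw [Finset.card_eq_zero, Finset.filter_eq_empty_iff] at c0
      have h3 := c0 (Finset.mem_univ a)
      have h4 := c0 (Finset.mem_univ b)
      have h5 := gdeg_line G (show G.Adj a b from hab)
      have h6 : ¬ gdeg G.lineGraph ⟨s(a, b), hab⟩ ≤ 2 := hdeg
      have h7 : gdeg G a ≤ 2 := by tauto
      have h8 : gdeg G b ≤ 2 := by tauto
      omega
    omega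
  · omega

lemma exists_inc {V : Type} (G : SimpleGraph V) (hG : G.Connected) (hn : Nontrivial V) (u : V) :
    ∃ e : G.edgeSet, u ∈ (e : Sym2 V) := by
  obtain ⟨w, hw⟩ := exists_ne u
  obtain ⟨x, y, _, hy, hxy⟩ := boundary G hG.preconnected {u} (a := u) (b := w) rfl hw
  obtain rfl : y = u := hy
  exact ⟨⟨s(x, y), hxy⟩, by simp⟩

lemma traceable_of_subsingleton {V : Type} (G : SimpleGraph V) (u : V) (h : ¬ Nontrivial V) :
    Traceable G := by
  rw [not_nontrivial_iff_subsingleton] at h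
  exact ⟨u, u, Walk.nil, by simp, fun w => by simp [Subsingleton.elim w u]⟩

theorem main_ind (k : ℕ) : ∀ (V : Type) [Fintype V] (G : SimpleGraph V), G.Connected →
    ∀ (u v : V) (t : G.Walk u v), t.IsTrail →
    lowc G {x | x ∈ t.support} + min 2 (highc G {x | x ∈ t.support}) ≤ k →
    ∃ j ≤ max 1 k, Traceable (iterLine ⟨V, G⟩ j).2 := by
  induction k using Nat.strong_induction_on with
  | _ k ih =>
  intro V _ G hG u v t ht hk
  classical
  by_cases hn : Nontrivial V
  swap
  · exact ⟨0, by simp, traceable_of_subsingleton G u hn⟩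
  obtain ⟨e0, he0⟩ := exists_inc G hG hn u
  have hne : ∃ e : G.edgeSet, ∃ x ∈ t.support, x ∈ (e : Sym2 V) := ⟨e0, u, by simp, he0⟩
  have := Fintype.ofFinite G.edgeSet
  by_cases hk1 : k ≤ 1
  · obtain ⟨a, b, q, hq, hs⟩ := exists_path G t ht hne
    refine ⟨1, by simp, a, b, q.mapLe (lineAt_le G _), hq.mapLe _, ?_⟩
    rintro ⟨⟨c, d⟩, hcd⟩
    change _ ∈ (q.mapLe (lineAt_le G _)).support
    rw [Walk.support_mapLe_eq_support]
    apply hs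
    by_contra hno
    push Not at hno
    have hc : c ∉ t.support := fun h => hno c h (by simp)
    have hd : d ∉ t.support := fun h => hno d h (by simp)
    have hcd' : G.Adj c d := hcd
    have h1 := lowc_add_highc G t.support.toFinset
    rw [List.coe_toFinset] at h1
    have h2 : ({c, d} : Finset V).card + t.support.toFinset.card ≤ Fintype.card V := by
      rw [← Finset.card_union_of_disjoint]
      · exact Finset.card_le_univ _
      · simp [hc, hd]
    rw [Finset.card_pair hcd'.ne] at h2
    omega
  · obtain ⟨A, hTA, hdeg, a, b, q, hq, hs⟩ := exists_maximal G t ht hne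
    have hL : G.lineGraph.Connected := by
      haveI : Nonempty G.edgeSet := ⟨e0⟩
      exact ⟨line_preconnected G hG.preconnected⟩
    have hm : lowc G.lineGraph {x | x ∈ q.support} + min 2 (highc G.lineGraph {x | x ∈ q.support})
        ≤ k - 1 := by
      by_cases hA : ∃ w, w ∉ A
      · obtain ⟨w, hw⟩ := hA
        obtain ⟨x, y, hx, hy, hxy⟩ := boundary G hG.preconnected A (hTA u (by simp)) hw
        have h1 := count_step G A {x | x ∈ q.support} hs x y hx hy hxy (hdeg x y hx hy hxy)
        have h2 := lowc_mono G (S := {x | x ∈ t.support}) (S' := A) hTA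
        have h3 := highc_mono G (S := {x | x ∈ t.support}) (S' := A) hTA
        omega
      · push Not at hA
        have hall : ∀ e, e ∈ q.support := by
          rintro ⟨⟨c, d⟩, hcd⟩
          exact hs _ ⟨c, hA c, by simp⟩
        simp [lowc, highc, hall]
    obtain ⟨j, hj, htr⟩ := ih (k - 1) (by omega) G.edgeSet G.lineGraph hL a b q hq hm
    exact ⟨j + 1, by omega, htr⟩

/-- `h_p(G) ≤ max {1, n - mt*(G)}`. -/
theorem stmt12 {V : Type} [Fintype V] [DecidableEq V] (G : SimpleGraph V)
    (hG : G.Connected) :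
    hp G ≤ max 1 (Fintype.card V - mtStar G) := by
  classical
  have hne : {m | ∃ (u v : V) (t : G.Walk u v), t.IsTrail ∧
      t.support.toFinset.card = m}.Nonempty := by
    obtain ⟨u⟩ := hG.nonempty
    exact ⟨_, u, u, Walk.nil, by simp, rfl⟩
  have hb : BddAbove {m | ∃ (u v : V) (t : G.Walk u v), t.IsTrail ∧
      t.support.toFinset.card = m} := by
    refine ⟨Fintype.card V, ?_⟩
    rintro m ⟨u, v, t, _, rfl⟩
    exact Finset.card_le_univ _
  obtain ⟨u, v, t, ht, hm⟩ := Nat.sSup_mem hne hb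
  have hm' : t.support.toFinset.card = mtStar G := hm
  have h1 := lowc_add_highc G t.support.toFinset
  rw [List.coe_toFinset] at h1
  obtain ⟨j, hj, htr⟩ := main_ind (Fintype.card V - mtStar G) V G hG u v t ht (by omega)
  exact (Nat.sInf_le (s := {n | Traceable (iterLine ⟨V, G⟩ n).2}) htr).trans hj
end Paper
end
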